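/- High-order consistency of the RMAC stencil for the auxiliary interpolants: let u=(u^x,u^y) ∈ W^{2,∞}([0,T];W^{4,∞}(Ω))² with ∇·u=0 on Ω and u=0 on ∂Ω, let β=∂_t u − μΔu with cell-averaged values β̂^{x,n}_{i,j+1/2}=(1/h_i)∫_{x_{i-1/2}}^{x_{i+1/2}}β^x(x,y_{j+1/2},t^n)dx and β̂^{y,n}_{i+1/2,j}=(1/k_j)∫_{y_{j-1/2}}^{y_{j+1/2}}β^y(x_{i+1/2},y,t^n)dy. Then there exist grid functions ε^{x,n}, ε^{y,n} at cell centers, ε^{x,y,n}, ε^{y,x,n} at nodes, and E^{x,n}, E^{y,n}, together with a constant C depending only on Ω, such that pointwise |ε^{x,n}|, |ε^{y,n}|, |ε^{x,y,n}|, |ε^{y,x,n}| ≤ C‖u‖_{L^∞([0,T];W^{3,∞}(Ω))}(h²+k²) and |E^{x,n}|, |E^{y,n}| ≤ C(1+μ)‖u‖_{W^{2,∞}([0,T];W^{4,∞}(Ω))}(h²+k²+Δt), and such that for all n≥1, 1≤i≤N_x−1, 0≤j≤N_y−1: d_tũ^{x,n}_{i,j+1/2} − μ(d_xũ^{x,n}_{i+1/2,j+1/2}−d_xũ^{x,n}_{i-1/2,j+1/2})/h_i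 − μ(D_yũ^{x,n}_{i,j+1}−D_yũ^{x,n}_{i,j})/k_{j+1/2} = β̂^{x,n}_{i,j+1/2} + E^{x,n}_{i,j+1/2} − (γ^{x,n}_{i+1/2,j+1/2}−γ^{x,n}_{i-1/2,j+1/2})/h_i − μ(ε^{x,n}_{i+1/2,j+1/2}−ε^{x,n}_{i-1/2,j+1/2})/h_i − μ(ε^{x,y,n}_{i,j+1}−ε^{x,y,n}_{i,j})/k_{j+1/2}, together with the symmetric identity for the y-component: d_tũ^{y,n}_{i+1/2,j} − μ(D_xũ^{y,n}_{i+1,j}−D_xũ^{y,n}_{i,j})/h_{i+1/2} − μ(d_yũ^{y,n}_{i+1/2,j+1/2}−d_yũ^{y,n}_{i+1/2,j-1/2})/k_j = β̂^{y,n}_{i+1/2,j} + E^{y,n}_{i+1/2,j} − (γ^{y,n}_{i+1/2,j+1/2}−γ^{y,n}_{i+1/2,j-1/2})/k_j − μ(ε^{y,n}_{i+1/2,j+1/2}−ε^{y,n}_{i+1/2,j-1/2})/k_j − μ(ε^{y,x,n}_{i+1,j}−ε^{y,x,n}_{i,j})/h_{i+1/2} for 0≤i≤N_x−1, 1≤j≤N_y−1.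 -/

import Mathlib

open Finset MeasureTheory Real

noncomputable section

namespace RMAC

/-! ### Continuous-level notions -/

/-- Partial derivative in the first (x) variable of a function of (x, y, t). -/
def pdx (f : ℝ → ℝ → ℝ → ℝ) : ℝ → ℝ → ℝ → ℝ := fun x y t => deriv (fun s => f s y t) x

/-- Partial derivative in the second (y) variable. -/
def pdy (f : ℝ → ℝ → ℝ → ℝ) : ℝ → ℝ → ℝ → ℝ := fun x y t => deriv (fun s => f x s t) y

/-- Partial derivative in the third (t) variable. -/
def pdt (f : ℝ → ℝ → ℝ → ℝ) : ℝ → ℝ → ℝ → ℝ := fun x y t => deriv (fun s => f x y s) t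

/-- Infinitely differentiable function of (x, y, t). -/
def Smooth (f : ℝ → ℝ → ℝ → ℝ) : Prop :=
  ∀ n : ℕ, ContDiff ℝ n (fun q : ℝ × ℝ × ℝ => f q.1 q.2.1 q.2.2)

/-- `SobBound a b f Lx Ly T M` : all derivatives `∂_t^{a'} ∂_x^{b'} ∂_y^{c'} f` with `a' ≤ a`,
`b' + c' ≤ b` are bounded by `M` on `[0,Lx] × [0,Ly] × [0,T]`; this encodes
`‖f‖_{W^{a,∞}([0,T];W^{b,∞}(Ω))} ≤ M`. -/
def SobBound (a b : ℕ) (f : ℝ → ℝ → ℝ → ℝ) (Lx Ly T M : ℝ) : Prop :=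
  ∀ a' b' c' : ℕ, a' ≤ a → b' + c' ≤ b →
    ∀ x y t : ℝ, x ∈ Set.Icc 0 Lx → y ∈ Set.Icc 0 Ly → t ∈ Set.Icc 0 T →
      |(pdt^[a'] (pdx^[b'] (pdy^[c'] f))) x y t| ≤ M

/-- The time-dependent Stokes problem on `Ω = (0,Lx) × (0,Ly)`, `t ∈ (0,T]`, with
viscosity `μ`, source `(gx, gy)`, homogeneous Dirichlet boundary condition and
homogeneous initial condition. -/
def IsStokesSol (μ Lx Ly T : ℝ) (ux uy p gx gy : ℝ → ℝ → ℝ → ℝ) : Prop :=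
  (∀ x y t : ℝ, x ∈ Set.Ioo 0 Lx → y ∈ Set.Ioo 0 Ly → t ∈ Set.Ioc 0 T →
      pdt ux x y t - μ * (pdx (pdx ux) x y t + pdy (pdy ux) x y t) + pdx p x y t = gx x y t ∧
      pdt uy x y t - μ * (pdx (pdx uy) x y t + pdy (pdy uy) x y t) + pdy p x y t = gy x y t ∧
      pdx ux x y t + pdy uy x y t = 0) ∧
  (∀ x y t : ℝ, x ∈ Set.Icc 0 Lx → y ∈ Set.Icc 0 Ly → t ∈ Set.Ioc 0 T →
      (x = 0 ∨ x = Lx ∨ y = 0 ∨ y = Ly) → ux x y t = 0 ∧ uy x y t = 0) ∧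
  (∀ x y : ℝ, x ∈ Set.Icc 0 Lx → y ∈ Set.Icc 0 Ly → ux x y 0 = 0 ∧ uy x y 0 = 0)

/-- Divergence-free velocity field on `Ω` for all times in `[0,T]`. -/
def DivFree (Lx Ly T : ℝ) (ux uy : ℝ → ℝ → ℝ → ℝ) : Prop :=
  ∀ x y t : ℝ, x ∈ Set.Ioo 0 Lx → y ∈ Set.Ioo 0 Ly → t ∈ Set.Icc 0 T →
    pdx ux x y t + pdy uy x y t = 0

/-- Homogeneous velocity boundary values on `∂Ω` for all times in `[0,T]`. -/
def BoundaryZero (Lx Ly T : ℝ) (ux uy : ℝ → ℝ → ℝ → ℝ) : Prop :=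
  ∀ x y t : ℝ, x ∈ Set.Icc 0 Lx → y ∈ Set.Icc 0 Ly → t ∈ Set.Icc 0 T →
    (x = 0 ∨ x = Lx ∨ y = 0 ∨ y = Ly) → ux x y t = 0 ∧ uy x y t = 0

/-! ### The staggered (MAC) grid

Index conventions for grid functions `f : ℤ → ℤ → ℝ`:
* cell-centered functions: `f i j` is the value at `(x_{i+1/2}, y_{j+1/2})`;
* x-edge functions (like `u^x`): `f i j` is the value at `(x_i, y_{j+1/2})`,
  with `j = -1` and `j = Ny` the ghost values representing `(x_i, y_0)` and `(x_i, y_{Ny})`;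
* y-edge functions (like `u^y`): `f i j` is the value at `(x_{i+1/2}, y_j)`,
  with `i = -1` and `i = Nx` the ghost values representing `(x_0, y_j)` and `(x_{Nx}, y_j)`;
* node functions: `f i j` is the value at `(x_i, y_j)`. -/
structure Grid where
  Nx : ℕ
  Ny : ℕ
  Lx : ℝ
  Ly : ℝ
  xp : ℤ → ℝ
  yp : ℤ → ℝ
  one_le_Nx : 1 ≤ Nx
  one_le_Ny : 1 ≤ Ny
  xp_zero : xp 0 = 0
  xp_last : xp Nx = Lx
  yp_zero : yp 0 = 0
  yp_last : yp Ny = Ly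
  xp_mono : ∀ i : ℤ, 0 ≤ i → i < Nx → xp i < xp (i + 1)
  yp_mono : ∀ j : ℤ, 0 ≤ j → j < Ny → yp j < yp (j + 1)

namespace Grid

variable (G : Grid)

/-- `h_{i+1/2} = x_{i+1} - x_i`. -/
def hh (i : ℤ) : ℝ := G.xp (i + 1) - G.xp i

/-- `k_{j+1/2} = y_{j+1} - y_j`. -/
def kk (j : ℤ) : ℝ := G.yp (j + 1) - G.yp j

/-- `x_{i+1/2} = (x_i + x_{i+1})/2`. -/
def xh (i : ℤ) : ℝ := (G.xp i + G.xp (i + 1)) / 2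

/-- `y_{j+1/2} = (y_j + y_{j+1})/2`. -/
def yh (j : ℤ) : ℝ := (G.yp j + G.yp (j + 1)) / 2

/-- `h_i = (h_{i-1/2} + h_{i+1/2})/2`, with `h_0 = h_{1/2}/2`, `h_{Nx} = h_{Nx-1/2}/2`. -/
def hc (i : ℤ) : ℝ :=
  if i = 0 then G.hh 0 / 2
  else if i = (G.Nx : ℤ) then G.hh ((G.Nx : ℤ) - 1) / 2
  else (G.hh (i - 1) + G.hh i) / 2

/-- `k_j = (k_{j-1/2} + k_{j+1/2})/2`, with `k_0 = k_{1/2}/2`, `k_{Ny} = k_{Ny-1/2}/2`. -/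
def kc (j : ℤ) : ℝ :=
  if j = 0 then G.kk 0 / 2
  else if j = (G.Ny : ℤ) then G.kk ((G.Ny : ℤ) - 1) / 2
  else (G.kk (j - 1) + G.kk j) / 2

/-- `h = max_i h_{i+1/2}`. -/
def hmax : ℝ :=
  (Finset.Icc (0 : ℤ) ((G.Nx : ℤ) - 1)).sup'
    (Finset.nonempty_Icc.mpr (by have := G.one_le_Nx; omega)) G.hh

/-- `k = max_j k_{j+1/2}`. -/
def kmax : ℝ :=
  (Finset.Icc (0 : ℤ) ((G.Ny : ℤ) - 1)).sup'
    (Finset.nonempty_Icc.mpr (by have := G.one_le_Ny; omega)) G.kk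

/-- Mesh regularity: `min_{i,j} {h_{i+1/2}, k_{j+1/2}} ≥ C₀ · max_{i,j} {h_{i+1/2}, k_{j+1/2}}`. -/
def Regular (C₀ : ℝ) : Prop :=
  (∀ i : ℤ, 0 ≤ i → i < G.Nx → C₀ * G.hmax ≤ G.hh i ∧ C₀ * G.kmax ≤ G.hh i) ∧
  (∀ j : ℤ, 0 ≤ j → j < G.Ny → C₀ * G.hmax ≤ G.kk j ∧ C₀ * G.kmax ≤ G.kk j)

/-! ### Difference operators -/

/-- `d_x` of an x-edge function: value at the cell center `(x_{i+1/2}, y_{j+1/2})`. -/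
def dxEx (f : ℤ → ℤ → ℝ) (i j : ℤ) : ℝ := (f (i + 1) j - f i j) / G.hh i

/-- `D_y` of an x-edge function: value at the node `(x_i, y_j)`. -/
def DyEx (f : ℤ → ℤ → ℝ) (i j : ℤ) : ℝ := (f i j - f i (j - 1)) / G.kc j

/-- `d_y` of a y-edge function: value at the cell center `(x_{i+1/2}, y_{j+1/2})`. -/
def dyEy (f : ℤ → ℤ → ℝ) (i j : ℤ) : ℝ := (f i (j + 1) - f i j) / G.kk j

/-- `D_x` of a y-edge function: value at the node `(x_i, y_j)`. -/
def DxEy (f : ℤ → ℤ → ℝ) (i j : ℤ) : ℝ := (f i j - f (i - 1) j) / G.hc i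

/-- `D_x` of a cell-centered function: value at the x-edge point `(x_i, y_{j+1/2})`. -/
def DxC (q : ℤ → ℤ → ℝ) (i j : ℤ) : ℝ := (q i j - q (i - 1) j) / G.hc i

/-- `D_y` of a cell-centered function: value at the y-edge point `(x_{i+1/2}, y_j)`. -/
def DyC (q : ℤ → ℤ → ℝ) (i j : ℤ) : ℝ := (q i j - q i (j - 1)) / G.kc j

/-! ### Discrete inner products and norms -/

/-- `(f,g)_{l²,M}` over cell centers. -/
def ipM (f g : ℤ → ℤ → ℝ) : ℝ :=
  ∑ i ∈ Finset.Icc (0 : ℤ) ((G.Nx : ℤ) - 1), ∑ j ∈ Finset.Icc (0 : ℤ) ((G.Ny : ℤ) - 1),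
    G.hh i * G.kk j * f i j * g i j

/-- `(f,g)_{l²,T,M}` over x-edge points. -/
def ipTM (f g : ℤ → ℤ → ℝ) : ℝ :=
  ∑ i ∈ Finset.Icc (1 : ℤ) ((G.Nx : ℤ) - 1), ∑ j ∈ Finset.Icc (0 : ℤ) ((G.Ny : ℤ) - 1),
    G.hc i * G.kk j * f i j * g i j

/-- `(f,g)_{l²,M,T}` over y-edge points. -/
def ipMT (f g : ℤ → ℤ → ℝ) : ℝ :=
  ∑ i ∈ Finset.Icc (0 : ℤ) ((G.Nx : ℤ) - 1), ∑ j ∈ Finset.Icc (1 : ℤ) ((G.Ny : ℤ) - 1),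
    G.hh i * G.kc j * f i j * g i j

/-- `(f,g)_{l²,T_x}`. -/
def ipTx (f g : ℤ → ℤ → ℝ) : ℝ :=
  ∑ i ∈ Finset.Icc (0 : ℤ) (G.Nx : ℤ), ∑ j ∈ Finset.Icc (1 : ℤ) ((G.Ny : ℤ) - 1),
    G.hc i * G.kc j * f i j * g i j

/-- `(f,g)_{l²,T_y}`. -/
def ipTy (f g : ℤ → ℤ → ℝ) : ℝ :=
  ∑ i ∈ Finset.Icc (1 : ℤ) ((G.Nx : ℤ) - 1), ∑ j ∈ Finset.Icc (0 : ℤ) (G.Ny : ℤ),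
    G.hc i * G.kc j * f i j * g i j

/-- `‖v‖²_{l²} = ‖v^x‖²_{l²,T,M} + ‖v^y‖²_{l²,M,T}` for a discrete velocity. -/
def velNormSq (vx vy : ℤ → ℤ → ℝ) : ℝ := G.ipTM vx vx + G.ipMT vy vy

/-- `‖Dv‖²_{l²}` for a discrete velocity. -/
def DvelNormSq (vx vy : ℤ → ℤ → ℝ) : ℝ :=
  G.ipM (G.dxEx vx) (G.dxEx vx) + G.ipTy (G.DyEx vx) (G.DyEx vx) +
    G.ipTx (G.DxEy vy) (G.DxEy vy) + G.ipM (G.dyEy vy) (G.dyEy vy)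

/-! ### Right-hand side discretization and the RMAC scheme -/

/-- `f^{x,n}_{i,j+1/2} = (1/h_i) ∫_{x_{i-1/2}}^{x_{i+1/2}} g^x(x, y_{j+1/2}, t^n) dx`. -/
def avgFx (gx : ℝ → ℝ → ℝ → ℝ) (Δt : ℝ) : ℕ → ℤ → ℤ → ℝ := fun n i j =>
  (1 / G.hc i) * ∫ x in (G.xh (i - 1))..(G.xh i), gx x (G.yh j) ((n : ℝ) * Δt)

/-- `f^{y,n}_{i+1/2,j} = (1/k_j) ∫_{y_{j-1/2}}^{y_{j+1/2}} g^y(x_{i+1/2}, y, t^n) dy`. -/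
def avgFy (gy : ℝ → ℝ → ℝ → ℝ) (Δt : ℝ) : ℕ → ℤ → ℤ → ℝ := fun n i j =>
  (1 / G.kc j) * ∫ y in (G.yh (j - 1))..(G.yh j), gy (G.xh i) y ((n : ℝ) * Δt)

/-- The RMAC scheme for the time-dependent Stokes equations, with discrete right-hand
sides `fx`, `fy`: homogeneous discrete boundary and initial conditions, the two discrete
momentum equations and the discrete divergence-free constraint. -/
def IsRMAC (μ Δt : ℝ) (fx fy Wx Wy Z : ℕ → ℤ → ℤ → ℝ) : Prop :=
  (∀ n : ℕ, ∀ j : ℤ, Wx n 0 j = 0 ∧ Wx n (G.Nx : ℤ) j = 0) ∧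
  (∀ n : ℕ, ∀ i : ℤ, Wx n i (-1) = 0 ∧ Wx n i (G.Ny : ℤ) = 0) ∧
  (∀ n : ℕ, ∀ i : ℤ, Wy n i 0 = 0 ∧ Wy n i (G.Ny : ℤ) = 0) ∧
  (∀ n : ℕ, ∀ j : ℤ, Wy n (-1) j = 0 ∧ Wy n (G.Nx : ℤ) j = 0) ∧
  (∀ i j : ℤ, Wx 0 i j = 0 ∧ Wy 0 i j = 0) ∧
  (∀ n : ℕ, 1 ≤ n →
    ∀ i ∈ Finset.Icc (1 : ℤ) ((G.Nx : ℤ) - 1), ∀ j ∈ Finset.Icc (0 : ℤ) ((G.Ny : ℤ) - 1),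
      (Wx n i j - Wx (n - 1) i j) / Δt
        - μ * ((G.dxEx (Wx n) i j - G.dxEx (Wx n) (i - 1) j) / G.hc i)
        - μ * ((G.DyEx (Wx n) i (j + 1) - G.DyEx (Wx n) i j) / G.kk j)
        + G.DxC (Z n) i j = fx n i j) ∧
  (∀ n : ℕ, 1 ≤ n →
    ∀ i ∈ Finset.Icc (0 : ℤ) ((G.Nx : ℤ) - 1), ∀ j ∈ Finset.Icc (1 : ℤ) ((G.Ny : ℤ) - 1),
      (Wy n i j - Wy (n - 1) i j) / Δt
        - μ * ((G.DxEy (Wy n) (i + 1) j - G.DxEy (Wy n) i j) / G.hh i)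
        - μ * ((G.dyEy (Wy n) i j - G.dyEy (Wy n) i (j - 1)) / G.kc j)
        + G.DyC (Z n) i j = fy n i j) ∧
  (∀ n : ℕ, 1 ≤ n →
    ∀ i ∈ Finset.Icc (0 : ℤ) ((G.Nx : ℤ) - 1), ∀ j ∈ Finset.Icc (0 : ℤ) ((G.Ny : ℤ) - 1),
      G.dxEx (Wx n) i j + G.dyEy (Wy n) i j = 0)

/-- The compact-support condition: the discrete solution vanishes within one mesh
layer of `∂Ω`. -/
def CompactSupp (Wx Wy Z : ℕ → ℤ → ℤ → ℝ) : Prop :=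
  (∀ n : ℕ, ∀ j : ℤ,
    Wx n 0 j = 0 ∧ Wx n 1 j = 0 ∧ Wx n ((G.Nx : ℤ) - 1) j = 0 ∧ Wx n (G.Nx : ℤ) j = 0) ∧
  (∀ n : ℕ, ∀ i : ℤ,
    Wx n i (-1) = 0 ∧ Wx n i 0 = 0 ∧ Wx n i ((G.Ny : ℤ) - 1) = 0 ∧ Wx n i (G.Ny : ℤ) = 0) ∧
  (∀ n : ℕ, ∀ j : ℤ,
    Wy n (-1) j = 0 ∧ Wy n 0 j = 0 ∧ Wy n ((G.Nx : ℤ) - 1) j = 0 ∧ Wy n (G.Nx : ℤ) j = 0) ∧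
  (∀ n : ℕ, ∀ i : ℤ,
    Wy n i 0 = 0 ∧ Wy n i 1 = 0 ∧ Wy n i ((G.Ny : ℤ) - 1) = 0 ∧ Wy n i (G.Ny : ℤ) = 0) ∧
  (∀ n : ℕ, ∀ j : ℤ, Z n 0 j = 0) ∧
  (∀ n : ℕ, ∀ i : ℤ, Z n i 0 = 0)

/-! ### Auxiliary interpolants and consistency functions -/

/-- The auxiliary interpolant `ũ^{x,n}_{i,j+1/2}`, with its boundary extension. -/
def tux (ux : ℝ → ℝ → ℝ → ℝ) (Δt : ℝ) (n : ℕ) (i j : ℤ) : ℝ :=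
  if j = -1 then ux (G.xp i) (G.yp 0) ((n : ℝ) * Δt)
  else if j = (G.Ny : ℤ) then ux (G.xp i) (G.yp (G.Ny : ℤ)) ((n : ℝ) * Δt)
  else (1 / G.kk j) * (∫ y in (G.yp j)..(G.yp (j + 1)), ux (G.xp i) y ((n : ℝ) * Δt))
    - (G.kk j) ^ 2 / 6 * pdy (pdy ux) (G.xp i) (G.yh j) ((n : ℝ) * Δt)

/-- The auxiliary interpolant `ũ^{y,n}_{i+1/2,j}`, with its boundary extension. -/
def tuy (uy : ℝ → ℝ → ℝ → ℝ) (Δt : ℝ) (n : ℕ) (i j : ℤ) : ℝ :=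
  if i = -1 then uy (G.xp 0) (G.yp j) ((n : ℝ) * Δt)
  else if i = (G.Nx : ℤ) then uy (G.xp (G.Nx : ℤ)) (G.yp j) ((n : ℝ) * Δt)
  else (1 / G.hh i) * (∫ x in (G.xp i)..(G.xp (i + 1)), uy x (G.yp j) ((n : ℝ) * Δt))
    - (G.hh i) ^ 2 / 6 * pdx (pdx uy) (G.xh i) (G.yp j) ((n : ℝ) * Δt)

/-- `γ^{x,n}_{i+1/2,j+1/2} = (h_{i+1/2}²/8) ∂²u^x/∂t∂x (x_{i+1/2}, y_{j+1/2}, t^n)`. -/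
def gammax (ux : ℝ → ℝ → ℝ → ℝ) (Δt : ℝ) (n : ℕ) (i j : ℤ) : ℝ :=
  (G.hh i) ^ 2 / 8 * pdt (pdx ux) (G.xh i) (G.yh j) ((n : ℝ) * Δt)

/-- `γ^{y,n}_{i+1/2,j+1/2} = (k_{j+1/2}²/8) ∂²u^y/∂t∂y (x_{i+1/2}, y_{j+1/2}, t^n)`. -/
def gammay (uy : ℝ → ℝ → ℝ → ℝ) (Δt : ℝ) (n : ℕ) (i j : ℤ) : ℝ :=
  (G.kk j) ^ 2 / 8 * pdt (pdy uy) (G.xh i) (G.yh j) ((n : ℝ) * Δt)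

end Grid

/-! ### Averaging (interpolation) operators on a uniform grid -/

/-- `P^x_h` : x-edge function → cell-centered function. -/
def PxEx (f : ℤ → ℤ → ℝ) (i j : ℤ) : ℝ := (f i j + f (i + 1) j) / 2

/-- `P^x_h` : cell-centered function → x-edge function. -/
def PxC (q : ℤ → ℤ → ℝ) (i j : ℤ) : ℝ := (q (i - 1) j + q i j) / 2

/-- `P^x_h` : y-edge function → node function. -/
def PxEyN (f : ℤ → ℤ → ℝ) (i j : ℤ) : ℝ := (f (i - 1) j + f i j) / 2

/-- `P^x_h` : node function → y-edge function. -/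
def PxN (g : ℤ → ℤ → ℝ) (i j : ℤ) : ℝ := (g i j + g (i + 1) j) / 2

/-- `P^y_h` : y-edge function → cell-centered function. -/
def PyEy (f : ℤ → ℤ → ℝ) (i j : ℤ) : ℝ := (f i j + f i (j + 1)) / 2

/-- `P^y_h` : cell-centered function → y-edge function. -/
def PyC (q : ℤ → ℤ → ℝ) (i j : ℤ) : ℝ := (q i (j - 1) + q i j) / 2

/-- `P^y_h` : x-edge function → node function. -/
def PyEx (f : ℤ → ℤ → ℝ) (i j : ℤ) : ℝ := (f i (j - 1) + f i j) / 2

/-- `P^y_h` : node function → x-edge function. -/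
def PyN (g : ℤ → ℤ → ℝ) (i j : ℤ) : ℝ := (g i j + g i (j + 1)) / 2

namespace Grid

variable (G : Grid)

/-- The discrete nonlinear term `α^{x,n}_{i,j+1/2}` of the fully implicit RMAC scheme. -/
def alphaX (Wx Wy : ℤ → ℤ → ℝ) (i j : ℤ) : ℝ :=
  (Wx i j * G.DxC (PxEx Wx) i j
    + PxC (G.dxEx fun a b => (Wx a b) ^ 2) i j
    + PyN (fun a b => PxEyN Wy a b * G.DyEx Wx a b) i j
    + (PyEx Wx i (j + 1) * PxEyN Wy i (j + 1) - PyEx Wx i j * PxEyN Wy i j) / G.kk j) / 2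

/-- The discrete nonlinear term `α^{y,n}_{i+1/2,j}` of the fully implicit RMAC scheme. -/
def alphaY (Wx Wy : ℤ → ℤ → ℝ) (i j : ℤ) : ℝ :=
  (Wy i j * G.DyC (PyEy Wy) i j
    + PyC (G.dyEy fun a b => (Wy a b) ^ 2) i j
    + PxN (fun a b => PyEx Wx a b * G.DxEy Wy a b) i j
    + (PyEx Wx (i + 1) j * PxEyN Wy (i + 1) j - PyEx Wx i j * PxEyN Wy i j) / G.hh i) / 2

/-- The fully implicit RMAC scheme for the Navier–Stokes equations. -/
def IsRMACNS (μ Δt : ℝ) (fx fy Wx Wy Z : ℕ → ℤ → ℤ → ℝ) : Prop :=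
  (∀ n : ℕ, ∀ j : ℤ, Wx n 0 j = 0 ∧ Wx n (G.Nx : ℤ) j = 0) ∧
  (∀ n : ℕ, ∀ i : ℤ, Wx n i (-1) = 0 ∧ Wx n i (G.Ny : ℤ) = 0) ∧
  (∀ n : ℕ, ∀ i : ℤ, Wy n i 0 = 0 ∧ Wy n i (G.Ny : ℤ) = 0) ∧
  (∀ n : ℕ, ∀ j : ℤ, Wy n (-1) j = 0 ∧ Wy n (G.Nx : ℤ) j = 0) ∧
  (∀ i j : ℤ, Wx 0 i j = 0 ∧ Wy 0 i j = 0) ∧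
  (∀ n : ℕ, 1 ≤ n →
    ∀ i ∈ Finset.Icc (1 : ℤ) ((G.Nx : ℤ) - 1), ∀ j ∈ Finset.Icc (0 : ℤ) ((G.Ny : ℤ) - 1),
      (Wx n i j - Wx (n - 1) i j) / Δt
        - μ * ((G.dxEx (Wx n) i j - G.dxEx (Wx n) (i - 1) j) / G.hc i)
        - μ * ((G.DyEx (Wx n) i (j + 1) - G.DyEx (Wx n) i j) / G.kk j)
        + G.alphaX (Wx n) (Wy n) i j
        + G.DxC (Z n) i j = fx n i j) ∧
  (∀ n : ℕ, 1 ≤ n →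
    ∀ i ∈ Finset.Icc (0 : ℤ) ((G.Nx : ℤ) - 1), ∀ j ∈ Finset.Icc (1 : ℤ) ((G.Ny : ℤ) - 1),
      (Wy n i j - Wy (n - 1) i j) / Δt
        - μ * ((G.DxEy (Wy n) (i + 1) j - G.DxEy (Wy n) i j) / G.hh i)
        - μ * ((G.dyEy (Wy n) i j - G.dyEy (Wy n) i (j - 1)) / G.kc j)
        + G.alphaY (Wx n) (Wy n) i j
        + G.DyC (Z n) i j = fy n i j) ∧
  (∀ n : ℕ, 1 ≤ n →
    ∀ i ∈ Finset.Icc (0 : ℤ) ((G.Nx : ℤ) - 1), ∀ j ∈ Finset.Icc (0 : ℤ) ((G.Ny : ℤ) - 1),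
      G.dxEx (Wx n) i j + G.dyEy (Wy n) i j = 0)

/-- A uniform grid with mesh sizes `h` (in x) and `k` (in y). -/
def Uniform (h k : ℝ) : Prop :=
  (∀ i : ℤ, 0 ≤ i → i < G.Nx → G.hh i = h) ∧ (∀ j : ℤ, 0 ≤ j → j < G.Ny → G.kk j = k)

end Grid

end RMAC


/-! ### One-dimensional Taylor estimates -/

section Taylor

open Set

variable {f f₁ f₂ f₃ f₄ : ℝ → ℝ} {K c x a b : ℝ}

theorem abs_sub_le_of_hasDerivAt (hf : ∀ s, HasDerivAt f (f₁ s) s)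
    (hK : ∀ s ∈ uIcc c x, |f₁ s| ≤ K) : |f x - f c| ≤ K * |x - c| :=
  (convex_uIcc c x).norm_image_sub_le_of_norm_hasDerivWithin_le
    (fun s _ => (hf s).hasDerivWithinAt) hK left_mem_uIcc right_mem_uIcc

theorem abs_taylor_one_le (hf : ∀ s, HasDerivAt f (f₁ s) s) (hf₁ : ∀ s, HasDerivAt f₁ (f₂ s) s)
    (hK : ∀ s ∈ uIcc c x, |f₂ s| ≤ K) :
    |f x - f c - f₁ c * (x - c)| ≤ K * |x - c| ^ 2 := by
  have hK0 : 0 ≤ K := (abs_nonneg _).trans (hK c left_mem_uIcc)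
  have hg : ∀ s, HasDerivAt (fun s => f s - f₁ c * (s - c)) (f₁ s - f₁ c) s := fun s => by
    exact ((hf s).sub (((hasDerivAt_id s).sub_const c).const_mul (f₁ c))).congr_deriv (by simp)
  have hb : ∀ s ∈ uIcc c x, |f₁ s - f₁ c| ≤ K * |x - c| := fun s hs =>
    (abs_sub_le_of_hasDerivAt hf₁ fun r hr => hK r (uIcc_subset_uIcc_left hs hr)).trans
      (mul_le_mul_of_nonneg_left (abs_sub_left_of_mem_uIcc hs) hK0)
  have := abs_sub_le_of_hasDerivAt hg hb
  calc _ = |f x - f₁ c * (x - c) - (f c - f₁ c * (c - c))| := by congr 1; ring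
    _ ≤ _ := this
    _ = _ := by ring

theorem abs_taylor_two_le (hf : ∀ s, HasDerivAt f (f₁ s) s) (hf₁ : ∀ s, HasDerivAt f₁ (f₂ s) s)
    (hf₂ : ∀ s, HasDerivAt f₂ (f₃ s) s) (hK : ∀ s ∈ uIcc c x, |f₃ s| ≤ K) :
    |f x - f c - f₁ c * (x - c) - f₂ c * (x - c) ^ 2 / 2| ≤ K * |x - c| ^ 3 := by
  have hK0 : 0 ≤ K := (abs_nonneg _).trans (hK c left_mem_uIcc)
  have hg : ∀ s, HasDerivAt (fun s => f s - f₂ c / 2 * (s - c) ^ 2)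
      (f₁ s - f₂ c * (s - c)) s := fun s => by
    refine ((hf s).sub ((((hasDerivAt_id s).sub_const c).pow 2).const_mul (f₂ c / 2))).congr_deriv ?_
    simp; ring
  have hg₁ : ∀ s, HasDerivAt (fun s => f₁ s - f₂ c * (s - c)) (f₂ s - f₂ c) s := fun s => by
    exact ((hf₁ s).sub (((hasDerivAt_id s).sub_const c).const_mul (f₂ c))).congr_deriv (by simp)
  have hb : ∀ s ∈ uIcc c x, |f₂ s - f₂ c| ≤ K * |x - c| := fun s hs =>
    (abs_sub_le_of_hasDerivAt hf₂ fun r hr => hK r (uIcc_subset_uIcc_left hs hr)).trans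
      (mul_le_mul_of_nonneg_left (abs_sub_left_of_mem_uIcc hs) hK0)
  have := abs_taylor_one_le hg hg₁ hb
  calc _ = _ := by congr 1; ring
    _ ≤ _ := this
    _ = _ := by ring

theorem abs_taylor_three_le (hf : ∀ s, HasDerivAt f (f₁ s) s)
    (hf₁ : ∀ s, HasDerivAt f₁ (f₂ s) s) (hf₂ : ∀ s, HasDerivAt f₂ (f₃ s) s)
    (hf₃ : ∀ s, HasDerivAt f₃ (f₄ s) s) (hK : ∀ s ∈ uIcc c x, |f₄ s| ≤ K) :
    |f x - f c - f₁ c * (x - c) - f₂ c * (x - c) ^ 2 / 2 - f₃ c * (x - c) ^ 3 / 6|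
      ≤ K * |x - c| ^ 4 := by
  have hK0 : 0 ≤ K := (abs_nonneg _).trans (hK c left_mem_uIcc)
  have hg : ∀ s, HasDerivAt (fun s => f s - f₃ c / 6 * (s - c) ^ 3)
      (f₁ s - f₃ c / 2 * (s - c) ^ 2) s := fun s => by
    refine ((hf s).sub ((((hasDerivAt_id s).sub_const c).pow 3).const_mul (f₃ c / 6))).congr_deriv ?_
    simp; ring
  have hg₁ : ∀ s, HasDerivAt (fun s => f₁ s - f₃ c / 2 * (s - c) ^ 2)
      (f₂ s - f₃ c * (s - c)) s := fun s => by
    refine ((hf₁ s).sub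
      ((((hasDerivAt_id s).sub_const c).pow 2).const_mul (f₃ c / 2))).congr_deriv ?_
    simp; ring
  have hg₂ : ∀ s, HasDerivAt (fun s => f₂ s - f₃ c * (s - c)) (f₃ s - f₃ c) s := fun s => by
    exact ((hf₂ s).sub (((hasDerivAt_id s).sub_const c).const_mul (f₃ c))).congr_deriv (by simp)
  have hb : ∀ s ∈ uIcc c x, |f₃ s - f₃ c| ≤ K * |x - c| := fun s hs =>
    (abs_sub_le_of_hasDerivAt hf₃ fun r hr => hK r (uIcc_subset_uIcc_left hs hr)).trans
      (mul_le_mul_of_nonneg_left (abs_sub_left_of_mem_uIcc hs) hK0)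
  have := abs_taylor_two_le hg hg₁ hg₂ hb
  calc _ = _ := by congr 1; ring
    _ ≤ _ := this
    _ = _ := by ring

theorem hasDerivAt_primitive (hf : ∀ s, HasDerivAt f (f₁ s) s) (c s : ℝ) :
    HasDerivAt (fun r => ∫ z in c..r, f z) (f s) s :=
  have hc : Continuous f := continuous_iff_continuousAt.2 fun s => (hf s).continuousAt
  (hc.integral_hasStrictDerivAt c s).hasDerivAt

/-- The divided difference of `f` approximates the derivative at the midpoint to second order. -/
theorem abs_divided_difference_sub_le (hf : ∀ s, HasDerivAt f (f₁ s) s)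
    (hf₁ : ∀ s, HasDerivAt f₁ (f₂ s) s) (hf₂ : ∀ s, HasDerivAt f₂ (f₃ s) s) (hab : a < b)
    (hK : ∀ s ∈ Icc a b, |f₃ s| ≤ K) :
    |(f b - f a) / (b - a) - f₁ ((a + b) / 2)| ≤ K * (b - a) ^ 2 := by
  have hm : (a + b) / 2 ∈ Icc a b := ⟨by linarith, by linarith⟩
  have hK0 : 0 ≤ K := (abs_nonneg _).trans (hK _ hm)
  have h0 : 0 < b - a := sub_pos.2 hab
  have hsub : ∀ d ∈ Icc a b, uIcc ((a + b) / 2) d ⊆ Icc a b := fun d hd =>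
    ordConnected_Icc.uIcc_subset hm hd
  have hb := abs_taylor_two_le hf hf₁ hf₂ fun s hs => hK s (hsub b ⟨hab.le, le_rfl⟩ hs)
  have ha := abs_taylor_two_le hf hf₁ hf₂ fun s hs => hK s (hsub a ⟨le_rfl, hab.le⟩ hs)
  rw [show b - (a + b) / 2 = (b - a) / 2 by ring, abs_of_pos (half_pos h0)] at hb
  rw [show a - (a + b) / 2 = -((b - a) / 2) by ring, abs_neg, abs_of_pos (half_pos h0)] at ha
  rw [abs_le] at ha hb
  have hKd : 0 ≤ K * (b - a) ^ 3 := by positivity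
  rw [div_sub' h0.ne', abs_div, abs_of_pos h0, div_le_iff₀ h0, abs_le]
  constructor <;> nlinarith

/-- The mean value of `f` approximates the value at the midpoint to second order. -/
theorem abs_average_sub_le (hf : ∀ s, HasDerivAt f (f₁ s) s)
    (hf₁ : ∀ s, HasDerivAt f₁ (f₂ s) s) (hab : a < b) (hK : ∀ s ∈ Icc a b, |f₂ s| ≤ K) :
    |1 / (b - a) * (∫ s in a..b, f s) - f ((a + b) / 2)| ≤ K * (b - a) ^ 2 := by
  have := abs_divided_difference_sub_le (hasDerivAt_primitive hf a) hf hf₁ hab hK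
  simpa [div_eq_inv_mul] using this

/-- One-sided expansion of the corrected mean value of `f` over the segment from `c` to `d`. -/
theorem abs_corrected_average_sub_le {d : ℝ} (hf : ∀ s, HasDerivAt f (f₁ s) s)
    (hf₁ : ∀ s, HasDerivAt f₁ (f₂ s) s) (hf₂ : ∀ s, HasDerivAt f₂ (f₃ s) s) (hcd : d ≠ c)
    (hK : ∀ s ∈ uIcc c d, |f₃ s| ≤ K) :
    |1 / (d - c) * (∫ s in c..d, f s) - (d - c) ^ 2 / 6 * f₂ ((c + d) / 2)
      - f c - f₁ c * (d - c) / 2| ≤ 2 * K * |d - c| ^ 3 := by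
  have hm : (c + d) / 2 ∈ uIcc c d := by
    rcases le_total c d with h | h
    · rw [uIcc_of_le h]; constructor <;> linarith
    · rw [uIcc_of_ge h]; constructor <;> linarith
  have hK0 : 0 ≤ K := (abs_nonneg _).trans (hK _ hm)
  have h0 : d - c ≠ 0 := sub_ne_zero.2 hcd
  have h0' : 0 < |d - c| := abs_pos.2 h0
  have hF := abs_taylor_three_le (hasDerivAt_primitive hf c) hf hf₁ hf₂ hK
  have hG := abs_sub_le_of_hasDerivAt hf₂ fun s hs => hK s (uIcc_subset_uIcc_left hm hs)
  rw [show (c + d) / 2 - c = (d - c) / 2 by ring, abs_div, abs_two] at hG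
  simp only [intervalIntegral.integral_same, sub_zero] at hF
  have e : 1 / (d - c) * (∫ s in c..d, f s) - (d - c) ^ 2 / 6 * f₂ ((c + d) / 2)
      - f c - f₁ c * (d - c) / 2
      = ((∫ s in c..d, f s) - f c * (d - c) - f₁ c * (d - c) ^ 2 / 2 - f₂ c * (d - c) ^ 3 / 6)
          / (d - c) - (d - c) ^ 2 / 6 * (f₂ ((c + d) / 2) - f₂ c) := by
    field_simp; ring
  rw [e]
  refine (abs_sub _ _).trans ?_
  rw [abs_div, abs_mul, abs_div, abs_pow, show |(6 : ℝ)| = 6 by norm_num]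
  have h1 := (div_le_iff₀ h0').2 (hF.trans_eq (by ring : _ = K * |d - c| ^ 3 * |d - c|))
  have h2 := mul_le_mul_of_nonneg_left hG (by positivity : 0 ≤ |d - c| ^ 2 / 6)
  have h3 : 0 ≤ K * |d - c| ^ 3 := by positivity
  nlinarith

/-- The mean value of `f` over an interval whose endpoints lie at distances `p / 2` and `q / 2`
from `c`, corrected by the first moments evaluated at the endpoints, approximates `f c` to second
order. -/
theorem abs_sub_average_add_moment_le {p q : ℝ} (hf : ∀ s, HasDerivAt f (f₁ s) s)
    (hf₁ : ∀ s, HasDerivAt f₁ (f₂ s) s) (hp : 0 < p) (hq : 0 < q)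
    (hK : ∀ s ∈ Icc (c - p / 2) (c + q / 2), |f₂ s| ≤ K) :
    |f c - 1 / ((p + q) / 2) * (∫ s in (c - p / 2)..(c + q / 2), f s)
      + (q ^ 2 / 8 * f₁ (c + q / 2) - p ^ 2 / 8 * f₁ (c - p / 2)) / ((p + q) / 2)|
      ≤ K * (p ^ 2 + q ^ 2) := by
  have hc : c ∈ Icc (c - p / 2) (c + q / 2) := ⟨by linarith, by linarith⟩
  have hK0 : 0 ≤ K := (abs_nonneg _).trans (hK _ hc)
  have hsub : ∀ d ∈ Icc (c - p / 2) (c + q / 2), uIcc c d ⊆ Icc (c - p / 2) (c + q / 2) :=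
    fun d hd => ordConnected_Icc.uIcc_subset hc hd
  have hqm := hsub (c + q / 2) ⟨by linarith, le_rfl⟩
  have hpm := hsub (c - p / 2) ⟨le_rfl, by linarith⟩
  have hcont : Continuous f := continuous_iff_continuousAt.2 fun s => (hf s).continuousAt
  have hF := hasDerivAt_primitive hf c
  have hIq := abs_taylor_two_le hF hf hf₁ fun s hs => hK s (hqm hs)
  have hIp := abs_taylor_two_le hF hf hf₁ fun s hs => hK s (hpm hs)
  have hDq := abs_sub_le_of_hasDerivAt hf₁ fun s hs => hK s (hqm hs)
  have hDp := abs_sub_le_of_hasDerivAt hf₁ fun s hs => hK s (hpm hs)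
  have hsplit : (∫ s in (c - p / 2)..(c + q / 2), f s)
      = (∫ s in c..(c + q / 2), f s) - ∫ s in c..(c - p / 2), f s := by
    rw [intervalIntegral.integral_interval_sub_left] <;> exact hcont.intervalIntegrable _ _
  rw [hsplit]
  simp only [intervalIntegral.integral_same, sub_zero, add_sub_cancel_left,
    show c - p / 2 - c = -(p / 2) by ring, abs_neg, abs_of_pos (half_pos hq),
    abs_of_pos (half_pos hp)] at hIq hIp hDq hDp
  generalize (∫ s in c..(c + q / 2), f s) = Iq at *
  generalize (∫ s in c..(c - p / 2), f s) = Ip at *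
  have hpq : 0 < (p + q) / 2 := by positivity
  have e : f c - 1 / ((p + q) / 2) * (Iq - Ip)
      + (q ^ 2 / 8 * f₁ (c + q / 2) - p ^ 2 / 8 * f₁ (c - p / 2)) / ((p + q) / 2)
      = (f c * ((p + q) / 2) - (Iq - Ip)
      + (q ^ 2 / 8 * f₁ (c + q / 2) - p ^ 2 / 8 * f₁ (c - p / 2))) / ((p + q) / 2) := by
    field_simp
  rw [e, abs_div, abs_of_pos hpq, div_le_iff₀ hpq]
  have hDq' : |q ^ 2 / 8 * (f₁ (c + q / 2) - f₁ c)| ≤ q ^ 2 / 8 * (K * (q / 2)) := by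
    rw [abs_mul, abs_of_nonneg (by positivity)]
    exact mul_le_mul_of_nonneg_left hDq (by positivity)
  have hDp' : |p ^ 2 / 8 * (f₁ (c - p / 2) - f₁ c)| ≤ p ^ 2 / 8 * (K * (p / 2)) := by
    rw [abs_mul, abs_of_nonneg (by positivity)]
    exact mul_le_mul_of_nonneg_left hDp (by positivity)
  have h1 : 0 ≤ K * p ^ 3 := by positivity
  have h2 : 0 ≤ K * q ^ 3 := by positivity
  have h3 : 0 ≤ K * p ^ 2 * q := by positivity
  have h4 : 0 ≤ K * p * q ^ 2 := by positivity
  rw [abs_le] at *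
  constructor <;> nlinarith

/-- The corrected mean value over `[a, b]`, applied to a difference `f - g` with small second
derivative, reproduces the difference at the midpoint to second order. -/
theorem abs_corrected_average_diff_sub_le {g g₁ g₂ : ℝ → ℝ} (hf : ∀ s, HasDerivAt f (f₁ s) s)
    (hf₁ : ∀ s, HasDerivAt f₁ (f₂ s) s) (hg : ∀ s, HasDerivAt g (g₁ s) s)
    (hg₁ : ∀ s, HasDerivAt g₁ (g₂ s) s) (hab : a < b)
    (hK : ∀ s ∈ Icc a b, |f₂ s - g₂ s| ≤ K) :
    |(1 / (b - a) * (∫ s in a..b, f s) - (b - a) ^ 2 / 6 * f₂ ((a + b) / 2))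
        - (1 / (b - a) * (∫ s in a..b, g s) - (b - a) ^ 2 / 6 * g₂ ((a + b) / 2))
        - (f ((a + b) / 2) - g ((a + b) / 2))| ≤ 2 * K * (b - a) ^ 2 := by
  have hm : (a + b) / 2 ∈ Icc a b := ⟨by linarith, by linarith⟩
  have hfc : Continuous f := continuous_iff_continuousAt.2 fun s => (hf s).continuousAt
  have hgc : Continuous g := continuous_iff_continuousAt.2 fun s => (hg s).continuousAt
  have h := abs_average_sub_le (fun s => (hf s).sub (hg s)) (fun s => (hf₁ s).sub (hg₁ s)) hab hK
  simp only [Pi.sub_apply] at h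
  rw [intervalIntegral.integral_sub (hfc.intervalIntegrable _ _)
    (hgc.intervalIntegrable _ _)] at h
  have h2 : |(b - a) ^ 2 / 6 * (f₂ ((a + b) / 2) - g₂ ((a + b) / 2))| ≤ (b - a) ^ 2 / 6 * K := by
    rw [abs_mul, abs_of_nonneg (by positivity)]
    exact mul_le_mul_of_nonneg_left (hK _ hm) (by positivity)
  have hK0 : 0 ≤ K * (b - a) ^ 2 := mul_nonneg ((abs_nonneg _).trans (hK _ hm)) (sq_nonneg _)
  rw [abs_le] at *
  constructor <;> nlinarith

end Taylor

/-! ### Partial derivatives of smooth functions -/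

namespace RMAC

section Partial

variable {f : ℝ → ℝ → ℝ → ℝ}

/-- A function of three variables as a function on the product space. -/
def uncurry₃ (f : ℝ → ℝ → ℝ → ℝ) (q : ℝ × ℝ × ℝ) : ℝ := f q.1 q.2.1 q.2.2

theorem Smooth.contDiff_uncurry (hf : Smooth f) (n : ℕ) : ContDiff ℝ n (uncurry₃ f) := hf n

theorem Smooth.differentiable_uncurry (hf : Smooth f) : Differentiable ℝ (uncurry₃ f) :=
  (hf.contDiff_uncurry 1).differentiable one_ne_zero

theorem Smooth.hasDerivAt_fderiv_x (hf : Smooth f) (x y t : ℝ) :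
    HasDerivAt (fun s => f s y t) (fderiv ℝ (uncurry₃ f) (x, y, t) (1, 0, 0)) x :=
  HasFDerivAt.comp_hasDerivAt (l := uncurry₃ f) x (hf.differentiable_uncurry (x, y, t)).hasFDerivAt
    ((hasDerivAt_id x).prodMk ((hasDerivAt_const x y).prodMk (hasDerivAt_const x t)))

theorem Smooth.hasDerivAt_fderiv_y (hf : Smooth f) (x y t : ℝ) :
    HasDerivAt (fun s => f x s t) (fderiv ℝ (uncurry₃ f) (x, y, t) (0, 1, 0)) y :=
  HasFDerivAt.comp_hasDerivAt (l := uncurry₃ f) y (hf.differentiable_uncurry (x, y, t)).hasFDerivAt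
    ((hasDerivAt_const y x).prodMk ((hasDerivAt_id y).prodMk (hasDerivAt_const y t)))

theorem Smooth.hasDerivAt_fderiv_t (hf : Smooth f) (x y t : ℝ) :
    HasDerivAt (fun s => f x y s) (fderiv ℝ (uncurry₃ f) (x, y, t) (0, 0, 1)) t :=
  HasFDerivAt.comp_hasDerivAt (l := uncurry₃ f) t (hf.differentiable_uncurry (x, y, t)).hasFDerivAt
    ((hasDerivAt_const t x).prodMk ((hasDerivAt_const t y).prodMk (hasDerivAt_id t)))

theorem Smooth.hasDerivAt_x (hf : Smooth f) (y t x : ℝ) :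
    HasDerivAt (fun s => f s y t) (pdx f x y t) x :=
  (hf.hasDerivAt_fderiv_x x y t).differentiableAt.hasDerivAt

theorem Smooth.hasDerivAt_y (hf : Smooth f) (x t y : ℝ) :
    HasDerivAt (fun s => f x s t) (pdy f x y t) y :=
  (hf.hasDerivAt_fderiv_y x y t).differentiableAt.hasDerivAt

theorem Smooth.hasDerivAt_t (hf : Smooth f) (x y t : ℝ) :
    HasDerivAt (fun s => f x y s) (pdt f x y t) t :=
  (hf.hasDerivAt_fderiv_t x y t).differentiableAt.hasDerivAt

theorem Smooth.uncurry_pdx (hf : Smooth f) :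
    uncurry₃ (pdx f) = fun q => fderiv ℝ (uncurry₃ f) q (1, 0, 0) :=
  funext fun q => (hf.hasDerivAt_fderiv_x q.1 q.2.1 q.2.2).deriv

theorem Smooth.uncurry_pdy (hf : Smooth f) :
    uncurry₃ (pdy f) = fun q => fderiv ℝ (uncurry₃ f) q (0, 1, 0) :=
  funext fun q => (hf.hasDerivAt_fderiv_y q.1 q.2.1 q.2.2).deriv

theorem Smooth.uncurry_pdt (hf : Smooth f) :
    uncurry₃ (pdt f) = fun q => fderiv ℝ (uncurry₃ f) q (0, 0, 1) :=
  funext fun q => (hf.hasDerivAt_fderiv_t q.1 q.2.1 q.2.2).deriv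

theorem Smooth.contDiff_fderiv_apply (hf : Smooth f) (v : ℝ × ℝ × ℝ) (n : ℕ) :
    ContDiff ℝ n (fun q => fderiv ℝ (uncurry₃ f) q v) :=
  ((hf.contDiff_uncurry (n + 1)).fderiv_right (m := n) (by norm_cast)).clm_apply contDiff_const

theorem Smooth.pdx (hf : Smooth f) : Smooth (pdx f) := fun n => by
  change ContDiff ℝ n (uncurry₃ (RMAC.pdx f))
  rw [hf.uncurry_pdx]; exact hf.contDiff_fderiv_apply _ n

theorem Smooth.pdy (hf : Smooth f) : Smooth (pdy f) := fun n => by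
  change ContDiff ℝ n (uncurry₃ (RMAC.pdy f))
  rw [hf.uncurry_pdy]; exact hf.contDiff_fderiv_apply _ n

theorem Smooth.pdt (hf : Smooth f) : Smooth (pdt f) := fun n => by
  change ContDiff ℝ n (uncurry₃ (RMAC.pdt f))
  rw [hf.uncurry_pdt]; exact hf.contDiff_fderiv_apply _ n

theorem Smooth.fderiv_fderiv_comm (hf : Smooth f) (v w q : ℝ × ℝ × ℝ) :
    fderiv ℝ (fun r => fderiv ℝ (uncurry₃ f) r v) q w
      = fderiv ℝ (fun r => fderiv ℝ (uncurry₃ f) r w) q v := by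
  have hd : DifferentiableAt ℝ (fderiv ℝ (uncurry₃ f)) q :=
    ((hf.contDiff_uncurry 2).fderiv_right (m := 1) (by norm_num)).differentiable one_ne_zero q
  have hs : IsSymmSndFDerivAt ℝ (uncurry₃ f) q :=
    (hf.contDiff_uncurry 2).contDiffAt.isSymmSndFDerivAt (by simp)
  rw [fderiv_clm_apply hd (differentiableAt_const v),
    fderiv_clm_apply hd (differentiableAt_const w)]
  simpa using hs.eq w v

theorem Smooth.pdx_pdt (hf : Smooth f) : RMAC.pdx (RMAC.pdt f) = RMAC.pdt (RMAC.pdx f) := by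
  have h : uncurry₃ (RMAC.pdx (RMAC.pdt f)) = uncurry₃ (RMAC.pdt (RMAC.pdx f)) := by
    rw [hf.pdt.uncurry_pdx, hf.pdx.uncurry_pdt, hf.uncurry_pdt, hf.uncurry_pdx]
    exact funext fun q => hf.fderiv_fderiv_comm _ _ q
  exact funext fun x => funext fun y => funext fun t => congrFun h (x, y, t)

theorem Smooth.pdx_pdy (hf : Smooth f) : RMAC.pdx (RMAC.pdy f) = RMAC.pdy (RMAC.pdx f) := by
  have h : uncurry₃ (RMAC.pdx (RMAC.pdy f)) = uncurry₃ (RMAC.pdy (RMAC.pdx f)) := by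
    rw [hf.pdy.uncurry_pdx, hf.pdx.uncurry_pdy, hf.uncurry_pdy, hf.uncurry_pdx]
    exact funext fun q => hf.fderiv_fderiv_comm _ _ q
  exact funext fun x => funext fun y => funext fun t => congrFun h (x, y, t)

theorem Smooth.iterate_pdy (hf : Smooth f) (c : ℕ) : Smooth (RMAC.pdy^[c] f) := by
  induction c with
  | zero => exact hf
  | succ c ih => rw [Function.iterate_succ_apply']; exact ih.pdy

theorem Smooth.pdx_iterate_pdy (hf : Smooth f) (c : ℕ) :
    RMAC.pdx (RMAC.pdy^[c] f) = RMAC.pdy^[c] (RMAC.pdx f) := by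
  induction c with
  | zero => rfl
  | succ c ih =>
    rw [Function.iterate_succ_apply', Function.iterate_succ_apply', (hf.iterate_pdy c).pdx_pdy, ih]

theorem Smooth.iterate_pdx_iterate_pdy (hf : Smooth f) (b c : ℕ) :
    RMAC.pdx^[b] (RMAC.pdy^[c] f) = RMAC.pdy^[c] (RMAC.pdx^[b] f) := by
  induction b generalizing f with
  | zero => rfl
  | succ b ih =>
    rw [Function.iterate_succ_apply, Function.iterate_succ_apply, hf.pdx_iterate_pdy, ih hf.pdx]

end Partial

/-! ### Exchanging the coordinate directions -/

section Swap

/-- Exchange the two space variables. -/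
def swapXY (f : ℝ → ℝ → ℝ → ℝ) : ℝ → ℝ → ℝ → ℝ := fun x y t => f y x t

theorem Smooth.swapXY {f : ℝ → ℝ → ℝ → ℝ} (hf : Smooth f) : Smooth (swapXY f) := fun n =>
  (hf n).comp (g := fun q : ℝ × ℝ × ℝ => f q.1 q.2.1 q.2.2)
    (f := fun q : ℝ × ℝ × ℝ => (q.2.1, q.1, q.2.2)) (by fun_prop)

theorem iterate_pdx_swapXY (f : ℝ → ℝ → ℝ → ℝ) (b : ℕ) :
    pdx^[b] (swapXY f) = swapXY (pdy^[b] f) :=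
  (Function.Semiconj.iterate_right (f := swapXY) (ga := pdy) (gb := pdx) (fun _ => rfl) b f).symm

theorem iterate_pdy_swapXY (f : ℝ → ℝ → ℝ → ℝ) (b : ℕ) :
    pdy^[b] (swapXY f) = swapXY (pdx^[b] f) :=
  (Function.Semiconj.iterate_right (f := swapXY) (ga := pdx) (gb := pdy) (fun _ => rfl) b f).symm

theorem iterate_pdt_swapXY (f : ℝ → ℝ → ℝ → ℝ) (b : ℕ) :
    pdt^[b] (swapXY f) = swapXY (pdt^[b] f) :=
  (Function.Semiconj.iterate_right (f := swapXY) (ga := pdt) (gb := pdt) (fun _ => rfl) b f).symm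

theorem SobBound.swapXY {f : ℝ → ℝ → ℝ → ℝ} (hf : Smooth f) {a b : ℕ} {Lx Ly T M : ℝ}
    (h : SobBound a b f Lx Ly T M) : SobBound a b (swapXY f) Ly Lx T M := by
  intro a' b' c' ha hbc x y t hx hy ht
  rw [iterate_pdy_swapXY, iterate_pdx_swapXY, iterate_pdt_swapXY, ← hf.iterate_pdx_iterate_pdy]
  exact h a' c' b' ha (by omega) y x t hy hx ht

/-- The grid with the two coordinate directions exchanged. -/
def Grid.swapXY (G : Grid) : Grid where
  Nx := G.Ny
  Ny := G.Nx
  Lx := G.Ly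
  Ly := G.Lx
  xp := G.yp
  yp := G.xp
  one_le_Nx := G.one_le_Ny
  one_le_Ny := G.one_le_Nx
  xp_zero := G.yp_zero
  xp_last := G.yp_last
  yp_zero := G.xp_zero
  yp_last := G.xp_last
  xp_mono := G.yp_mono
  yp_mono := G.xp_mono

end Swap

/-! ### Elementary properties of the grid -/

namespace Grid

variable (G : Grid)

theorem hh_pos {i : ℤ} (h0 : 0 ≤ i) (h1 : i < G.Nx) : 0 < G.hh i := sub_pos.2 (G.xp_mono i h0 h1)

theorem hh_le_hmax {i : ℤ} (h0 : 0 ≤ i) (h1 : i < G.Nx) : G.hh i ≤ G.hmax :=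
  Finset.le_sup' G.hh (Finset.mem_Icc.2 ⟨h0, by omega⟩)

theorem xp_mono_nat (i : ℤ) (h0 : 0 ≤ i) (m : ℕ) (h : i + m ≤ G.Nx) :
    G.xp i ≤ G.xp (i + m) := by
  induction m with
  | zero => simp
  | succ m ih =>
    push_cast at h ⊢
    rw [← add_assoc]
    exact (ih (by omega)).trans (G.xp_mono (i + m) (by omega) (by omega)).le

theorem xp_mem {i : ℤ} (h0 : 0 ≤ i) (h1 : i ≤ G.Nx) : G.xp i ∈ Set.Icc 0 G.Lx := by
  constructor
  · have := G.xp_mono_nat 0 le_rfl i.toNat (by omega)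
    rwa [G.xp_zero, zero_add, Int.toNat_of_nonneg h0] at this
  · have := G.xp_mono_nat i h0 (G.Nx - i).toNat (by omega)
    rwa [Int.toNat_of_nonneg (by omega), add_sub_cancel, G.xp_last] at this

theorem kk_pos {j : ℤ} (h0 : 0 ≤ j) (h1 : j < G.Ny) : 0 < G.kk j := G.swapXY.hh_pos h0 h1

theorem kk_le_kmax {j : ℤ} (h0 : 0 ≤ j) (h1 : j < G.Ny) : G.kk j ≤ G.kmax :=
  G.swapXY.hh_le_hmax h0 h1

theorem yp_mem {j : ℤ} (h0 : 0 ≤ j) (h1 : j ≤ G.Ny) : G.yp j ∈ Set.Icc 0 G.Ly :=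
  G.swapXY.xp_mem h0 h1

theorem Icc_xp_subset {i : ℤ} (h0 : 0 ≤ i) (h1 : i < G.Nx) :
    Set.Icc (G.xp i) (G.xp (i + 1)) ⊆ Set.Icc 0 G.Lx :=
  Set.Icc_subset_Icc (G.xp_mem h0 h1.le).1 (G.xp_mem (by omega) (by omega)).2

theorem Icc_yp_subset {j : ℤ} (h0 : 0 ≤ j) (h1 : j < G.Ny) :
    Set.Icc (G.yp j) (G.yp (j + 1)) ⊆ Set.Icc 0 G.Ly := G.swapXY.Icc_xp_subset h0 h1

theorem yh_mem {j : ℤ} (h0 : 0 ≤ j) (h1 : j < G.Ny) : G.yh j ∈ Set.Icc 0 G.Ly := by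
  have h := G.yp_mono j h0 h1
  exact G.Icc_yp_subset h0 h1 ⟨by unfold yh; linarith, by unfold yh; linarith⟩

theorem xh_mem {i : ℤ} (h0 : 0 ≤ i) (h1 : i < G.Nx) : G.xh i ∈ Set.Icc 0 G.Lx :=
  G.swapXY.yh_mem h0 h1

end Grid
end RMAC

/-! ### Consistency of the individual difference operators -/

namespace RMAC.Grid

variable (G : Grid) {u : ℝ → ℝ → ℝ → ℝ} {Δt T M : ℝ} {n : ℕ} {i j : ℤ}

theorem tux_of_mem (hj0 : 0 ≤ j) (hj1 : j < G.Ny) :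
    G.tux u Δt n i j = 1 / (G.yp (j + 1) - G.yp j)
        * (∫ y in (G.yp j)..(G.yp (j + 1)), u (G.xp i) y ((n : ℝ) * Δt))
      - (G.yp (j + 1) - G.yp j) ^ 2 / 6
        * pdy (pdy u) (G.xp i) ((G.yp j + G.yp (j + 1)) / 2) ((n : ℝ) * Δt) := by
  rw [tux, if_neg (by omega), if_neg (by omega)]
  rfl

theorem abs_dxEx_tux_sub_le (hu : Smooth u) (hM : SobBound 0 3 u G.Lx G.Ly T M)
    (ht : (n : ℝ) * Δt ∈ Set.Icc 0 T) (hi0 : 0 ≤ i) (hi1 : i < G.Nx) (hj0 : 0 ≤ j)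
    (hj1 : j < G.Ny) :
    |G.dxEx (G.tux u Δt n) i j - pdx u (G.xh i) (G.yh j) ((n : ℝ) * Δt)|
      ≤ 2 * M * (G.hh i ^ 2 + G.kk j ^ 2) := by
  have hx := G.xp_mono i hi0 hi1
  have hy := G.yp_mono j hj0 hj1
  have hh := G.hh_pos hi0 hi1
  have hxs := G.Icc_xp_subset hi0 hi1
  set t := (n : ℝ) * Δt with ht_def
  have hM0 : 0 ≤ M := (abs_nonneg _).trans
    (hM 0 0 0 le_rfl (by norm_num) (G.xh i) (G.yh j) t (G.xh_mem hi0 hi1) (G.yh_mem hj0 hj1) ht)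
  have hK : ∀ y ∈ Set.Icc (G.yp j) (G.yp (j + 1)),
      |pdy (pdy u) (G.xp (i + 1)) y t - pdy (pdy u) (G.xp i) y t| ≤ M * G.hh i := fun y hy' => by
    have := abs_sub_le_of_hasDerivAt (hu.pdy.pdy.hasDerivAt_x y t) (K := M) (c := G.xp i)
      (x := G.xp (i + 1)) fun s hs => hM 0 1 2 le_rfl (by norm_num) s y t
        (hxs (by rwa [Set.uIcc_of_le hx.le] at hs)) (G.Icc_yp_subset hj0 hj1 hy') ht
    rwa [show G.xp (i + 1) - G.xp i = G.hh i from rfl, abs_of_pos hh] at this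
  have h1 := abs_corrected_average_diff_sub_le (hu.hasDerivAt_y (G.xp (i + 1)) t)
    (hu.pdy.hasDerivAt_y _ t) (hu.hasDerivAt_y (G.xp i) t) (hu.pdy.hasDerivAt_y _ t) hy hK
  have h2 := abs_divided_difference_sub_le (hu.hasDerivAt_x (G.yh j) t)
    (hu.pdx.hasDerivAt_x _ t) (hu.pdx.pdx.hasDerivAt_x _ t) hx (K := M) fun s hs =>
      hM 0 3 0 le_rfl (by norm_num) s _ t (hxs hs) (G.yh_mem hj0 hj1) ht
  rw [dxEx, G.tux_of_mem hj0 hj1, G.tux_of_mem hj0 hj1, ← ht_def]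
  set A := 1 / (G.yp (j + 1) - G.yp j) * (∫ y in (G.yp j)..(G.yp (j + 1)), u (G.xp (i + 1)) y t)
    - (G.yp (j + 1) - G.yp j) ^ 2 / 6
      * pdy (pdy u) (G.xp (i + 1)) ((G.yp j + G.yp (j + 1)) / 2) t
  set B := 1 / (G.yp (j + 1) - G.yp j) * (∫ y in (G.yp j)..(G.yp (j + 1)), u (G.xp i) y t)
    - (G.yp (j + 1) - G.yp j) ^ 2 / 6 * pdy (pdy u) (G.xp i) ((G.yp j + G.yp (j + 1)) / 2) t
  change |A - B - (u (G.xp (i + 1)) (G.yh j) t - u (G.xp i) (G.yh j) t)|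
    ≤ 2 * (M * G.hh i) * G.kk j ^ 2 at h1
  change |(u (G.xp (i + 1)) (G.yh j) t - u (G.xp i) (G.yh j) t) / G.hh i
    - pdx u (G.xh i) (G.yh j) t| ≤ M * G.hh i ^ 2 at h2
  have h3 : |(A - B - (u (G.xp (i + 1)) (G.yh j) t - u (G.xp i) (G.yh j) t)) / G.hh i|
      ≤ 2 * M * G.kk j ^ 2 := by
    rw [abs_div, abs_of_pos hh, div_le_iff₀ hh]
    linarith
  rw [sub_div] at h3
  have h4 : 0 ≤ M * G.hh i ^ 2 := by positivity
  rw [abs_le] at *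
  constructor <;> linarith

theorem abs_dt_tux_sub_le (hu : Smooth u) (hM : SobBound 2 4 u G.Lx G.Ly T M) (hΔt : 0 < Δt)
    (hn : 1 ≤ n) (ht : (n : ℝ) * Δt ∈ Set.Icc 0 T) (hi0 : 0 ≤ i) (hi1 : i ≤ G.Nx)
    (hj0 : 0 ≤ j) (hj1 : j < G.Ny) :
    |(G.tux u Δt n i j - G.tux u Δt (n - 1) i j) / Δt
      - pdt u (G.xp i) (G.yh j) ((n : ℝ) * Δt)| ≤ 2 * M * (G.kk j ^ 2 + Δt) := by
  have hy := G.yp_mono j hj0 hj1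
  have hx := G.xp_mem hi0 hi1
  have hpred : ((n - 1 : ℕ) : ℝ) * Δt = (n : ℝ) * Δt - Δt := by
    rw [Nat.cast_sub hn]; push_cast; ring
  have hpos : 0 ≤ (n : ℝ) * Δt - Δt := by rw [← hpred]; positivity
  rw [G.tux_of_mem hj0 hj1, G.tux_of_mem hj0 hj1, hpred]
  set t := (n : ℝ) * Δt
  have hM0 : 0 ≤ M := (abs_nonneg _).trans
    (hM 0 0 0 (by norm_num) (by norm_num) (G.xp i) (G.yh j) t hx (G.yh_mem hj0 hj1) ht)
  have htm : ∀ s ∈ Set.uIcc t (t - Δt), s ∈ Set.Icc 0 T := fun s hs => by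
    rw [Set.uIcc_of_ge (by linarith)] at hs
    exact ⟨hpos.trans hs.1, hs.2.trans ht.2⟩
  have hK : ∀ y ∈ Set.Icc (G.yp j) (G.yp (j + 1)),
      |pdy (pdy u) (G.xp i) y t - pdy (pdy u) (G.xp i) y (t - Δt)| ≤ M * Δt := fun y hy' => by
    have := abs_sub_le_of_hasDerivAt (hu.pdy.pdy.hasDerivAt_t (G.xp i) y) (K := M) (c := t)
      (x := t - Δt) fun s hs => hM 1 0 2 (by norm_num) (by norm_num) (G.xp i) y s hx
        (G.Icc_yp_subset hj0 hj1 hy') (htm s hs)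
    rwa [abs_sub_comm, abs_sub_comm (t - Δt), sub_sub_cancel, abs_of_pos hΔt] at this
  have h1 := abs_corrected_average_diff_sub_le (hu.hasDerivAt_y (G.xp i) t)
    (hu.pdy.hasDerivAt_y _ t) (hu.hasDerivAt_y (G.xp i) (t - Δt))
    (hu.pdy.hasDerivAt_y _ (t - Δt)) hy hK
  have h2 := abs_taylor_one_le (hu.hasDerivAt_t (G.xp i) (G.yh j)) (hu.pdt.hasDerivAt_t _ _)
    (K := M) (c := t) (x := t - Δt) fun s hs => hM 2 0 0 le_rfl (by norm_num) _ _ s hx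
      (G.yh_mem hj0 hj1) (htm s hs)
  rw [show t - Δt - t = -Δt by ring, abs_neg, abs_of_pos hΔt] at h2
  set A := 1 / (G.yp (j + 1) - G.yp j) * (∫ y in (G.yp j)..(G.yp (j + 1)), u (G.xp i) y t)
    - (G.yp (j + 1) - G.yp j) ^ 2 / 6
      * pdy (pdy u) (G.xp i) ((G.yp j + G.yp (j + 1)) / 2) t
  set B := 1 / (G.yp (j + 1) - G.yp j)
      * (∫ y in (G.yp j)..(G.yp (j + 1)), u (G.xp i) y (t - Δt))
    - (G.yp (j + 1) - G.yp j) ^ 2 / 6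
      * pdy (pdy u) (G.xp i) ((G.yp j + G.yp (j + 1)) / 2) (t - Δt)
  change |A - B - (u (G.xp i) (G.yh j) t - u (G.xp i) (G.yh j) (t - Δt))|
    ≤ 2 * (M * Δt) * G.kk j ^ 2 at h1
  have h4 : 0 ≤ M * Δt ^ 2 := by positivity
  rw [div_sub' hΔt.ne', abs_div, abs_of_pos hΔt, div_le_iff₀ hΔt]
  rw [abs_le] at *
  constructor <;> linarith

theorem pow_three_le_kmax (hj0 : 0 ≤ j) (hj1 : j < G.Ny) :
    G.kk j ^ 3 ≤ G.kmax ^ 2 * G.kk j := by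
  have h0 := G.kk_pos hj0 hj1
  have := mul_le_mul_of_nonneg_right
    (pow_le_pow_left₀ h0.le (G.kk_le_kmax hj0 hj1) 2) h0.le
  linarith [pow_succ (G.kk j) 2]

theorem abs_tux_sub_bottom_le (hu : Smooth u) (hM : SobBound 0 3 u G.Lx G.Ly T M)
    (ht : (n : ℝ) * Δt ∈ Set.Icc 0 T) (hi0 : 0 ≤ i) (hi1 : i ≤ G.Nx) (hj0 : 0 ≤ j)
    (hj1 : j < G.Ny) :
    |G.tux u Δt n i j - u (G.xp i) (G.yp j) ((n : ℝ) * Δt)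
      - pdy u (G.xp i) (G.yp j) ((n : ℝ) * Δt) * G.kk j / 2| ≤ 2 * M * (G.kmax ^ 2 * G.kk j) := by
  have hy := G.yp_mono j hj0 hj1
  have hM0 : 0 ≤ M := (abs_nonneg _).trans
    (hM 0 0 0 le_rfl (by norm_num) (G.xp i) (G.yh j) _ (G.xp_mem hi0 hi1) (G.yh_mem hj0 hj1) ht)
  have h := abs_corrected_average_sub_le (hu.hasDerivAt_y (G.xp i) ((n : ℝ) * Δt))
    (hu.pdy.hasDerivAt_y _ _) (hu.pdy.pdy.hasDerivAt_y _ _) hy.ne' (K := M) fun s hs =>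
      hM 0 0 3 le_rfl (by norm_num) _ s _ (G.xp_mem hi0 hi1)
        (G.Icc_yp_subset hj0 hj1 (by rwa [Set.uIcc_of_le hy.le] at hs)) ht
  rw [abs_of_pos (sub_pos.2 hy)] at h
  rw [G.tux_of_mem hj0 hj1]
  exact h.trans (mul_le_mul_of_nonneg_left (G.pow_three_le_kmax hj0 hj1) (by positivity))

theorem abs_tux_sub_top_le (hu : Smooth u) (hM : SobBound 0 3 u G.Lx G.Ly T M)
    (ht : (n : ℝ) * Δt ∈ Set.Icc 0 T) (hi0 : 0 ≤ i) (hi1 : i ≤ G.Nx) (hj0 : 0 ≤ j)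
    (hj1 : j < G.Ny) :
    |G.tux u Δt n i j - u (G.xp i) (G.yp (j + 1)) ((n : ℝ) * Δt)
      + pdy u (G.xp i) (G.yp (j + 1)) ((n : ℝ) * Δt) * G.kk j / 2|
      ≤ 2 * M * (G.kmax ^ 2 * G.kk j) := by
  have hy := G.yp_mono j hj0 hj1
  have hM0 : 0 ≤ M := (abs_nonneg _).trans
    (hM 0 0 0 le_rfl (by norm_num) (G.xp i) (G.yh j) _ (G.xp_mem hi0 hi1) (G.yh_mem hj0 hj1) ht)
  have h := abs_corrected_average_sub_le (hu.hasDerivAt_y (G.xp i) ((n : ℝ) * Δt))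
    (hu.pdy.hasDerivAt_y _ _) (hu.pdy.pdy.hasDerivAt_y _ _) hy.ne (K := M) fun s hs =>
      hM 0 0 3 le_rfl (by norm_num) _ s _ (G.xp_mem hi0 hi1)
        (G.Icc_yp_subset hj0 hj1 (by rwa [Set.uIcc_of_ge hy.le] at hs)) ht
  rw [abs_sub_comm (G.yp j), abs_of_pos (sub_pos.2 hy), intervalIntegral.integral_symm,
    ← neg_sub (G.yp (j + 1)) (G.yp j), add_comm (G.yp (j + 1))] at h
  rw [G.tux_of_mem hj0 hj1]
  refine le_trans (le_of_eq ?_)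
    (h.trans (mul_le_mul_of_nonneg_left (G.pow_three_le_kmax hj0 hj1) (by positivity)))
  congr 1
  rw [one_div, one_div, inv_neg, kk]
  ring

theorem abs_DyEx_tux_sub_le (hu : Smooth u) (hM : SobBound 0 3 u G.Lx G.Ly T M)
    (ht : (n : ℝ) * Δt ∈ Set.Icc 0 T) (hi0 : 0 ≤ i) (hi1 : i ≤ G.Nx) (hj0 : 0 ≤ j)
    (hj1 : j ≤ G.Ny) :
    |G.DyEx (G.tux u Δt n) i j - pdy u (G.xp i) (G.yp j) ((n : ℝ) * Δt)|
      ≤ 4 * M * G.kmax ^ 2 := by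
  have hNy := G.one_le_Ny
  have htop : 0 < j → _ := fun h =>
    G.abs_tux_sub_top_le hu hM ht hi0 hi1 (j := j - 1) (by omega) (by omega)
  rw [sub_add_cancel] at htop
  have hbot : j < G.Ny → _ := G.abs_tux_sub_bottom_le hu hM ht hi0 hi1 (j := j) hj0
  rw [DyEx]
  rcases hj0.eq_or_lt with rfl | hj0'
  · have hk : 0 < G.kk 0 := G.kk_pos le_rfl (by omega)
    have h := hbot (by omega)
    rw [show G.kc 0 = G.kk 0 / 2 from if_pos rfl,
      show G.tux u Δt n i (0 - 1) = u (G.xp i) (G.yp 0) ((n : ℝ) * Δt) from if_pos rfl,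
      div_sub' (half_pos hk).ne', abs_div, abs_of_pos (half_pos hk), div_le_iff₀ (half_pos hk)]
    rw [abs_le] at *
    constructor <;> linarith
  rcases hj1.eq_or_lt with rfl | hj1'
  · have hk : 0 < G.kk (G.Ny - 1) := G.kk_pos (by omega) (by omega)
    have h := htop hj0'
    rw [show G.kc (G.Ny : ℤ) = G.kk (G.Ny - 1) / 2 by rw [kc, if_neg (by omega), if_pos rfl],
      show G.tux u Δt n i G.Ny = u (G.xp i) (G.yp G.Ny) ((n : ℝ) * Δt) by
        rw [tux, if_neg (by omega), if_pos rfl],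
      div_sub' (half_pos hk).ne', abs_div, abs_of_pos (half_pos hk), div_le_iff₀ (half_pos hk)]
    rw [abs_le] at *
    constructor <;> linarith
  · have hk : 0 < G.kk (j - 1) := G.kk_pos (by omega) (by omega)
    have hk' : 0 < G.kk j := G.kk_pos hj0 hj1'
    have hc : 0 < (G.kk (j - 1) + G.kk j) / 2 := by positivity
    have h := htop hj0'
    have h' := hbot hj1'
    rw [show G.kc j = (G.kk (j - 1) + G.kk j) / 2 by rw [kc, if_neg (by omega), if_neg (by omega)],
      div_sub' hc.ne', abs_div, abs_of_pos hc, div_le_iff₀ hc]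
    rw [abs_le] at *
    constructor <;> linarith

theorem hc_of_mem (hi0 : 1 ≤ i) (hi1 : i < G.Nx) : G.hc i = (G.hh (i - 1) + G.hh i) / 2 := by
  rw [hc, if_neg (by omega), if_neg (by omega)]

/-- Replacing a point value by a cell average on the dual grid costs a discrete derivative of
second-order moments. -/
theorem abs_sub_dual_average_le {f : ℝ → ℝ → ℝ → ℝ} (hf : Smooth f) {K y t : ℝ}
    (hK : ∀ x ∈ Set.Icc 0 G.Lx, |pdx (pdx f) x y t| ≤ K) (hi0 : 1 ≤ i) (hi1 : i < G.Nx) :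
    |f (G.xp i) y t - 1 / G.hc i * (∫ x in (G.xh (i - 1))..(G.xh i), f x y t)
      + (G.hh i ^ 2 / 8 * pdx f (G.xh i) y t
        - G.hh (i - 1) ^ 2 / 8 * pdx f (G.xh (i - 1)) y t) / G.hc i| ≤ 2 * K * G.hmax ^ 2 := by
  have hp : 0 < G.hh (i - 1) := G.hh_pos (by omega) (by omega)
  have hq : 0 < G.hh i := G.hh_pos (by omega) hi1
  have hpm : G.hh (i - 1) ≤ G.hmax := G.hh_le_hmax (by omega) (by omega)
  have hqm : G.hh i ≤ G.hmax := G.hh_le_hmax (by omega) hi1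
  have ep : G.xh (i - 1) = G.xp i - G.hh (i - 1) / 2 := by
    rw [xh, hh, sub_add_cancel]; ring
  have eq : G.xh i = G.xp i + G.hh i / 2 := by rw [xh, hh]; ring
  have hK0 : 0 ≤ K := (abs_nonneg _).trans (hK _ (G.xp_mem (by omega) hi1.le))
  have h := abs_sub_average_add_moment_le (hf.hasDerivAt_x y t) (hf.pdx.hasDerivAt_x y t) hp hq
    (c := G.xp i) (K := K) fun s hs => by
      rw [← ep, ← eq] at hs
      exact hK s ⟨(G.xh_mem (by omega) (by omega)).1.trans hs.1,
        hs.2.trans (G.xh_mem (by omega) hi1).2⟩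
  rw [ep, eq, G.hc_of_mem hi0 hi1]
  have h1 := pow_le_pow_left₀ hp.le hpm 2
  have h2 := pow_le_pow_left₀ hq.le hqm 2
  exact h.trans ((mul_le_mul_of_nonneg_left (add_le_add h1 h2) hK0).trans_eq (by ring))

end RMAC.Grid

/-! ### Consistency of the momentum stencil -/

namespace RMAC.Grid

variable (G : Grid)

/-- The residual of the `x`-momentum stencil in the consistency identity, for given
consistency functions `εx` and `εxy`. -/
def residualX (μ : ℝ) (u : ℝ → ℝ → ℝ → ℝ) (Δt : ℝ) (εx εxy : ℕ → ℤ → ℤ → ℝ)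
    (n : ℕ) (i j : ℤ) : ℝ :=
  (G.tux u Δt n i j - G.tux u Δt (n - 1) i j) / Δt
    - μ * ((G.dxEx (G.tux u Δt n) i j - G.dxEx (G.tux u Δt n) (i - 1) j) / G.hc i)
    - μ * ((G.DyEx (G.tux u Δt n) i (j + 1) - G.DyEx (G.tux u Δt n) i j) / G.kk j)
    - (1 / G.hc i) * (∫ x in (G.xh (i - 1))..(G.xh i),
        (pdt u x (G.yh j) ((n : ℝ) * Δt)
          - μ * (pdx (pdx u) x (G.yh j) ((n : ℝ) * Δt)
            + pdy (pdy u) x (G.yh j) ((n : ℝ) * Δt))))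
    + (G.gammax u Δt n i j - G.gammax u Δt n (i - 1) j) / G.hc i
    + μ * ((εx n i j - εx n (i - 1) j) / G.hc i)
    + μ * ((εxy n i (j + 1) - εxy n i j) / G.kk j)

/-- The cell-centered consistency function `ε^x`, extended by zero. -/
def epsX (u : ℝ → ℝ → ℝ → ℝ) (Δt : ℝ) (n : ℕ) (i j : ℤ) : ℝ :=
  if (0 ≤ i ∧ i < G.Nx) ∧ 0 ≤ j ∧ j < G.Ny then
    G.dxEx (G.tux u Δt n) i j - pdx u (G.xh i) (G.yh j) ((n : ℝ) * Δt)
      - G.hh i ^ 2 / 8 * pdx (pdy (pdy u)) (G.xh i) (G.yh j) ((n : ℝ) * Δt)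
  else 0

/-- The nodal consistency function `ε^{x,y}`, extended by zero. -/
def epsXY (u : ℝ → ℝ → ℝ → ℝ) (Δt : ℝ) (n : ℕ) (i j : ℤ) : ℝ :=
  if (0 ≤ i ∧ i ≤ G.Nx) ∧ 0 ≤ j ∧ j ≤ G.Ny then
    G.DyEx (G.tux u Δt n) i j - pdy u (G.xp i) (G.yp j) ((n : ℝ) * Δt)
  else 0

variable {u : ℝ → ℝ → ℝ → ℝ} {Δt T M μ : ℝ} {n : ℕ} {i j : ℤ}

theorem SobBound_nonneg {a b : ℕ} (hM : SobBound a b u G.Lx G.Ly T M) (hT : 0 ≤ T) : 0 ≤ M :=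
  (abs_nonneg _).trans (hM 0 0 0 (Nat.zero_le _) (Nat.zero_le _) _ _ 0
    (G.xp_mem le_rfl (Nat.cast_nonneg _)) (G.yp_mem le_rfl (Nat.cast_nonneg _)) ⟨le_rfl, hT⟩)

theorem abs_epsX_le (hu : Smooth u) (hM : SobBound 0 3 u G.Lx G.Ly T M)
    (ht : (n : ℝ) * Δt ∈ Set.Icc 0 T) :
    |G.epsX u Δt n i j| ≤ 8 * M * (G.hmax ^ 2 + G.kmax ^ 2) := by
  have hM0 := G.SobBound_nonneg hM (ht.1.trans ht.2)
  unfold epsX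
  split_ifs with h
  · obtain ⟨⟨hi0, hi1⟩, hj0, hj1⟩ := h
    have h1 := G.abs_dxEx_tux_sub_le hu hM ht hi0 hi1 hj0 hj1
    have h2 : |G.hh i ^ 2 / 8 * pdx (pdy (pdy u)) (G.xh i) (G.yh j) ((n : ℝ) * Δt)|
        ≤ G.hh i ^ 2 / 8 * M := by
      rw [abs_mul, abs_of_nonneg (by positivity)]
      exact mul_le_mul_of_nonneg_left (hM 0 1 2 le_rfl (by norm_num) _ _ _ (G.xh_mem hi0 hi1)
        (G.yh_mem hj0 hj1) ht) (by positivity)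
    have h3 := mul_le_mul_of_nonneg_left
      (pow_le_pow_left₀ (G.hh_pos hi0 hi1).le (G.hh_le_hmax hi0 hi1) 2) hM0
    have h4 := mul_le_mul_of_nonneg_left
      (pow_le_pow_left₀ (G.kk_pos hj0 hj1).le (G.kk_le_kmax hj0 hj1) 2) hM0
    have h5 : 0 ≤ M * G.hmax ^ 2 := by positivity
    have h6 : 0 ≤ M * G.kmax ^ 2 := by positivity
    refine (abs_sub _ _).trans ?_
    linarith
  · rw [abs_zero]; positivity

theorem abs_epsXY_le (hu : Smooth u) (hM : SobBound 0 3 u G.Lx G.Ly T M)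
    (ht : (n : ℝ) * Δt ∈ Set.Icc 0 T) :
    |G.epsXY u Δt n i j| ≤ 8 * M * (G.hmax ^ 2 + G.kmax ^ 2) := by
  have hM0 := G.SobBound_nonneg hM (ht.1.trans ht.2)
  unfold epsXY
  split_ifs with h
  · have h5 : 0 ≤ M * G.hmax ^ 2 := by positivity
    have h6 : 0 ≤ M * G.kmax ^ 2 := by positivity
    linarith [G.abs_DyEx_tux_sub_le (Δt := Δt) (n := n) hu hM ht h.1.1 h.1.2 h.2.1 h.2.2]
  · rw [abs_zero]; positivity

theorem abs_residualX_le (hu : Smooth u) (hM : SobBound 2 4 u G.Lx G.Ly T M) (hμ : 0 < μ)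
    (hΔt : 0 < Δt) (hn : 1 ≤ n) (ht : (n : ℝ) * Δt ∈ Set.Icc 0 T) (hi0 : 1 ≤ i)
    (hi1 : i < G.Nx) (hj0 : 0 ≤ j) (hj1 : j < G.Ny) :
    |G.residualX μ u Δt (G.epsX u Δt) (G.epsXY u Δt) n i j|
      ≤ 8 * (1 + μ) * M * (G.hmax ^ 2 + G.kmax ^ 2 + Δt) := by
  have hM0 := G.SobBound_nonneg hM (ht.1.trans ht.2)
  have hyh := G.yh_mem hj0 hj1
  have hxi := G.xp_mem (i := i) (by omega) hi1.le
  have hkk := mul_le_mul_of_nonneg_left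
    (pow_le_pow_left₀ (G.kk_pos hj0 hj1).le (G.kk_le_kmax hj0 hj1) 2) hM0
  have h1 := G.abs_dt_tux_sub_le hu hM hΔt hn ht (i := i) (by omega) hi1.le hj0 hj1
  have h2 := G.abs_sub_dual_average_le hu.pdt (K := M) (y := G.yh j) (t := n * Δt)
    (fun x hx => by
      rw [hu.pdx_pdt, hu.pdx.pdx_pdt]
      exact hM 1 2 0 (by norm_num) (by norm_num) x _ _ hx hyh ht) hi0 hi1
  have h3 := G.abs_sub_dual_average_le hu.pdy.pdy (K := M) (y := G.yh j) (t := n * Δt)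
    (fun x hx => hM 0 2 2 (by norm_num) (by norm_num) x _ _ hx hyh ht) hi0 hi1
  have h4 := abs_divided_difference_sub_le (hu.pdy.hasDerivAt_y (G.xp i) (n * Δt))
    (hu.pdy.pdy.hasDerivAt_y _ _) (hu.pdy.pdy.pdy.hasDerivAt_y _ _) (G.yp_mono j hj0 hj1)
    (K := M) fun s hs => hM 0 0 4 (by norm_num) le_rfl _ s _ hxi (G.Icc_yp_subset hj0 hj1 hs) ht
  rw [hu.pdx_pdt] at h2
  have hsplit : (∫ x in (G.xh (i - 1))..(G.xh i), (pdt u x (G.yh j) ((n : ℝ) * Δt)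
          - μ * (pdx (pdx u) x (G.yh j) ((n : ℝ) * Δt)
            + pdy (pdy u) x (G.yh j) ((n : ℝ) * Δt))))
      = (∫ x in (G.xh (i - 1))..(G.xh i), pdt u x (G.yh j) ((n : ℝ) * Δt))
        - μ * ((pdx u (G.xh i) (G.yh j) ((n : ℝ) * Δt)
            - pdx u (G.xh (i - 1)) (G.yh j) ((n : ℝ) * Δt))
          + ∫ x in (G.xh (i - 1))..(G.xh i), pdy (pdy u) x (G.yh j) ((n : ℝ) * Δt)) := by
    have hint : ∀ {f : ℝ → ℝ → ℝ → ℝ}, Smooth f → IntervalIntegrable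
        (fun x => f x (G.yh j) ((n : ℝ) * Δt)) volume (G.xh (i - 1)) (G.xh i) := fun hf =>
      (continuous_iff_continuousAt.2 fun s =>
        (hf.hasDerivAt_x _ _ s).continuousAt).intervalIntegrable _ _
    rw [intervalIntegral.integral_sub (hint hu.pdt)
      (((hint hu.pdx.pdx).add (hint hu.pdy.pdy)).const_mul μ),
      intervalIntegral.integral_const_mul,
      intervalIntegral.integral_add (hint hu.pdx.pdx) (hint hu.pdy.pdy),
      intervalIntegral.integral_eq_sub_of_hasDerivAt
        (fun x _ => hu.pdx.hasDerivAt_x (G.yh j) ((n : ℝ) * Δt) x) (hint hu.pdx.pdx)]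
  rw [residualX, hsplit, epsX, if_pos (by omega), epsX, if_pos (by omega), epsXY,
    if_pos (by omega), epsXY, if_pos (by omega), gammax, gammax]
  change |(pdy u (G.xp i) (G.yp (j + 1)) (n * Δt) - pdy u (G.xp i) (G.yp j) (n * Δt)) / G.kk j
    - pdy (pdy u) (G.xp i) (G.yh j) (n * Δt)| ≤ M * G.kk j ^ 2 at h4
  generalize (G.tux u Δt n i j - G.tux u Δt (n - 1) i j) / Δt = Dt at *
  generalize (∫ x in (G.xh (i - 1))..(G.xh i), pdt u x (G.yh j) ((n : ℝ) * Δt)) = It at *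
  generalize (∫ x in (G.xh (i - 1))..(G.xh i), pdy (pdy u) x (G.yh j) ((n : ℝ) * Δt)) = Iy at *
  have h5 := mul_le_mul_of_nonneg_left (abs_add_le _ _ |>.trans (add_le_add h3 h4)) hμ.le
  rw [← abs_of_pos hμ, ← abs_mul, abs_of_pos hμ] at h5
  have h6 := (abs_sub _ _).trans (add_le_add ((abs_add_le _ _).trans (add_le_add h1 h2)) h5)
  have h7 := mul_le_mul_of_nonneg_left hkk hμ.le
  refine le_trans (le_of_eq ?_) (h6.trans ?_)
  · congr 1; ring
  · have a1 : 0 ≤ M * G.hmax ^ 2 := by positivity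
    have a2 : 0 ≤ M * G.kmax ^ 2 := by positivity
    have a3 : 0 ≤ M * Δt := by positivity
    have b1 : 0 ≤ μ * (M * G.hmax ^ 2) := by positivity
    have b2 : 0 ≤ μ * (M * G.kmax ^ 2) := by positivity
    have b3 : 0 ≤ μ * (M * Δt) := by positivity
    linarith

/-- The consistency identity for the `x`-component, with explicit constants. -/
theorem exists_consistency_x (hu : Smooth u) {M3 M24 : ℝ} {N : ℕ} (hT : 0 < T) (hN : 1 ≤ N)
    (hΔ : Δt = T / N) (hμ : 0 < μ) (hM3 : SobBound 0 3 u G.Lx G.Ly T M3)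
    (hM24 : SobBound 2 4 u G.Lx G.Ly T M24) :
    ∃ εx εxy E : ℕ → ℤ → ℤ → ℝ,
      (∀ n : ℕ, 1 ≤ n → n ≤ N → ∀ i j : ℤ,
        |εx n i j| ≤ 8 * M3 * (G.hmax ^ 2 + G.kmax ^ 2) ∧
        |εxy n i j| ≤ 8 * M3 * (G.hmax ^ 2 + G.kmax ^ 2) ∧
        |E n i j| ≤ 8 * (1 + μ) * M24 * (G.hmax ^ 2 + G.kmax ^ 2 + Δt)) ∧
      ∀ n : ℕ, ∀ i ∈ Finset.Icc (1 : ℤ) ((G.Nx : ℤ) - 1),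
        ∀ j ∈ Finset.Icc (0 : ℤ) ((G.Ny : ℤ) - 1),
          (G.tux u Δt n i j - G.tux u Δt (n - 1) i j) / Δt
            - μ * ((G.dxEx (G.tux u Δt n) i j - G.dxEx (G.tux u Δt n) (i - 1) j) / G.hc i)
            - μ * ((G.DyEx (G.tux u Δt n) i (j + 1) - G.DyEx (G.tux u Δt n) i j) / G.kk j)
          = (1 / G.hc i) * (∫ x in (G.xh (i - 1))..(G.xh i),
                (pdt u x (G.yh j) ((n : ℝ) * Δt)
                  - μ * (pdx (pdx u) x (G.yh j) ((n : ℝ) * Δt)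
                       + pdy (pdy u) x (G.yh j) ((n : ℝ) * Δt))))
            + E n i j
            - (G.gammax u Δt n i j - G.gammax u Δt n (i - 1) j) / G.hc i
            - μ * ((εx n i j - εx n (i - 1) j) / G.hc i)
            - μ * ((εxy n i (j + 1) - εxy n i j) / G.kk j) := by
  have hN0 : (0 : ℝ) < N := by exact_mod_cast hN
  have hΔt : 0 < Δt := hΔ ▸ div_pos hT hN0
  have hM0 := G.SobBound_nonneg hM24 hT.le
  refine ⟨G.epsX u Δt, G.epsXY u Δt, fun n i j =>
    if (1 ≤ i ∧ i < G.Nx) ∧ 0 ≤ j ∧ j < G.Ny then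
      G.residualX μ u Δt (G.epsX u Δt) (G.epsXY u Δt) n i j else 0, ?_, ?_⟩
  · intro n hn hnN i j
    have ht : (n : ℝ) * Δt ∈ Set.Icc 0 T := by
      refine ⟨by positivity, ?_⟩
      calc (n : ℝ) * Δt ≤ N * Δt := by gcongr
        _ = T := by rw [hΔ]; field_simp
    refine ⟨G.abs_epsX_le hu hM3 ht, G.abs_epsXY_le hu hM3 ht, ?_⟩
    dsimp only
    split_ifs with h
    · exact G.abs_residualX_le hu hM24 hμ hΔt hn ht h.1.1 h.1.2 h.2.1 h.2.2
    · rw [abs_zero]; positivity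
  · intro n i hi j hj
    rw [Finset.mem_Icc] at hi hj
    dsimp only
    rw [if_pos (by omega), residualX]
    ring

end RMAC.Grid

open RMAC

/-- high-order consistency of the RMAC stencil for the auxiliary
interpolants. There are grid functions `ε^{x}`, `ε^{y}`, `ε^{x,y}`, `ε^{y,x}` of size
`O(‖u‖_{L^∞W^{3,∞}}(h²+k²))` and `E^x`, `E^y` of size
`O((1+μ)‖u‖_{W^{2,∞}W^{4,∞}}(h²+k²+Δt))` such that the auxiliary interpolants satisfy the
RMAC momentum stencils with right-hand side the cell averages of `β = ∂_t u − μΔu`, up to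
these consistency terms and the `γ` terms. -/
theorem rmac_consistency (Lx Ly : ℝ) (hLx : 0 < Lx) (hLy : 0 < Ly) :
    ∃ C : ℝ, 0 < C ∧
      ∀ T : ℝ, 0 < T → ∀ N : ℕ, 1 ≤ N → ∀ Δt : ℝ, Δt = T / N →
      ∀ μ : ℝ, 0 < μ →
      ∀ G : RMAC.Grid, G.Lx = Lx → G.Ly = Ly →
      ∀ ux uy : ℝ → ℝ → ℝ → ℝ, RMAC.Smooth ux → RMAC.Smooth uy →
        RMAC.DivFree Lx Ly T ux uy → RMAC.BoundaryZero Lx Ly T ux uy →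
      ∀ M3 M24 : ℝ,
        RMAC.SobBound 0 3 ux Lx Ly T M3 → RMAC.SobBound 0 3 uy Lx Ly T M3 →
        RMAC.SobBound 2 4 ux Lx Ly T M24 → RMAC.SobBound 2 4 uy Lx Ly T M24 →
      ∃ εx εy εxy εyx Ex Ey : ℕ → ℤ → ℤ → ℝ,
        (∀ n : ℕ, 1 ≤ n → n ≤ N → ∀ i j : ℤ,
          |εx n i j| ≤ C * M3 * (G.hmax ^ 2 + G.kmax ^ 2) ∧
          |εy n i j| ≤ C * M3 * (G.hmax ^ 2 + G.kmax ^ 2) ∧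
          |εxy n i j| ≤ C * M3 * (G.hmax ^ 2 + G.kmax ^ 2) ∧
          |εyx n i j| ≤ C * M3 * (G.hmax ^ 2 + G.kmax ^ 2) ∧
          |Ex n i j| ≤ C * (1 + μ) * M24 * (G.hmax ^ 2 + G.kmax ^ 2 + Δt) ∧
          |Ey n i j| ≤ C * (1 + μ) * M24 * (G.hmax ^ 2 + G.kmax ^ 2 + Δt)) ∧
        (∀ n : ℕ, 1 ≤ n → n ≤ N →
          ∀ i ∈ Finset.Icc (1 : ℤ) ((G.Nx : ℤ) - 1),
          ∀ j ∈ Finset.Icc (0 : ℤ) ((G.Ny : ℤ) - 1),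
            (G.tux ux Δt n i j - G.tux ux Δt (n - 1) i j) / Δt
              - μ * ((G.dxEx (G.tux ux Δt n) i j - G.dxEx (G.tux ux Δt n) (i - 1) j) / G.hc i)
              - μ * ((G.DyEx (G.tux ux Δt n) i (j + 1) - G.DyEx (G.tux ux Δt n) i j) / G.kk j)
            = (1 / G.hc i) * (∫ x in (G.xh (i - 1))..(G.xh i),
                  (RMAC.pdt ux x (G.yh j) ((n : ℝ) * Δt)
                    - μ * (RMAC.pdx (RMAC.pdx ux) x (G.yh j) ((n : ℝ) * Δt)
                         + RMAC.pdy (RMAC.pdy ux) x (G.yh j) ((n : ℝ) * Δt))))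
              + Ex n i j
              - (G.gammax ux Δt n i j - G.gammax ux Δt n (i - 1) j) / G.hc i
              - μ * ((εx n i j - εx n (i - 1) j) / G.hc i)
              - μ * ((εxy n i (j + 1) - εxy n i j) / G.kk j)) ∧
        (∀ n : ℕ, 1 ≤ n → n ≤ N →
          ∀ i ∈ Finset.Icc (0 : ℤ) ((G.Nx : ℤ) - 1),
          ∀ j ∈ Finset.Icc (1 : ℤ) ((G.Ny : ℤ) - 1),
            (G.tuy uy Δt n i j - G.tuy uy Δt (n - 1) i j) / Δt
              - μ * ((G.DxEy (G.tuy uy Δt n) (i + 1) j - G.DxEy (G.tuy uy Δt n) i j) / G.hh i)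
              - μ * ((G.dyEy (G.tuy uy Δt n) i j - G.dyEy (G.tuy uy Δt n) i (j - 1)) / G.kc j)
            = (1 / G.kc j) * (∫ y in (G.yh (j - 1))..(G.yh j),
                  (RMAC.pdt uy (G.xh i) y ((n : ℝ) * Δt)
                    - μ * (RMAC.pdx (RMAC.pdx uy) (G.xh i) y ((n : ℝ) * Δt)
                         + RMAC.pdy (RMAC.pdy uy) (G.xh i) y ((n : ℝ) * Δt))))
              + Ey n i j
              - (G.gammay uy Δt n i j - G.gammay uy Δt n i (j - 1)) / G.kc j
              - μ * ((εy n i j - εy n i (j - 1)) / G.kc j)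
              - μ * ((εyx n (i + 1) j - εyx n i j) / G.hh i)) := by
  refine ⟨8, by norm_num, ?_⟩
  rintro T hT N hN Δt hΔ μ hμ G rfl rfl ux uy hux huy - - M3 M24 hx3 hy3 hx24 hy24
  obtain ⟨εx, εxy, Ex, hbx, hx⟩ := G.exists_consistency_x hux hT hN hΔ hμ hx3 hx24
  obtain ⟨εy, εyx, Ey, hby, hy⟩ := G.swapXY.exists_consistency_x huy.swapXY hT hN hΔ hμ
    (hy3.swapXY huy) (hy24.swapXY huy)
  refine ⟨εx, fun n i j => εy n j i, εxy, fun n i j => εyx n j i, Ex, fun n i j => Ey n j i,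
    fun n hn hnN i j => ?_, fun n _ _ => hx n, fun n _ _ i hi j hj => ?_⟩
  · obtain ⟨h1, h2, h3⟩ := hbx n hn hnN i j
    obtain ⟨h4, h5, h6⟩ := hby n hn hnN j i
    change |εy n j i| ≤ 8 * M3 * (G.kmax ^ 2 + G.hmax ^ 2) at h4
    change |εyx n j i| ≤ 8 * M3 * (G.kmax ^ 2 + G.hmax ^ 2) at h5
    change |Ey n j i| ≤ 8 * (1 + μ) * M24 * (G.kmax ^ 2 + G.hmax ^ 2 + Δt) at h6
    rw [add_comm (G.kmax ^ 2)] at h4 h5 h6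
    exact ⟨h1, h4, h2, h5, h3, h6⟩
  · have h := hy n j hj i hi
    simp only [add_comm (pdx (pdx (swapXY uy)) _ _ _)] at h
    rw [sub_right_comm]
    exact h
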